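/- arXiv:math/0609723 — 4 statements merged into one kernel-verified Lean document; each statement's English description precedes it below -/
import Mathlib

section
/- In the polynomial ring 𝔽_p[X] one has the identity Σ_{i=0}^{p-2} v_{-i}·X^i = v_{-(p-2)} · ∏_{k=0, k≠1}^{p-2} (X − v_k); equivalently, there exists R(X) ∈ ℤ[X] of degree smaller than p−2 such that P(X) = v_{-(p-2)} · ∏_{k=0, k≠1}^{p-2} (X − v_k) + p·R(X) in ℤ[X]. -/
open Finset Polynomial

theorem aux_deg {R : Type*} [CommRing R] [Nontrivial R] (a b : ℕ → R) (n : ℕ) (s : Finset ℕ)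
    (hs : s.card = n) :
    (∑ i ∈ Finset.range (n + 1), Polynomial.C (a i) * Polynomial.X ^ i -
      Polynomial.C (a n) * ∏ k ∈ s, (Polynomial.X - Polynomial.C (b k))).degree < (n : WithBot ℕ) := by
  have hm : (∏ k ∈ s, (Polynomial.X - Polynomial.C (b k))).Monic :=
    monic_prod_of_monic _ _ (fun i _ => monic_X_sub_C _)
  have hd : (∏ k ∈ s, (Polynomial.X - Polynomial.C (b k))).natDegree = n := by
    rw [natDegree_prod_of_monic _ _ (fun i _ => monic_X_sub_C _)]
    simp [hs]
  rw [Polynomial.degree_lt_iff_coeff_zero]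
  intro m hm'
  simp only [coeff_sub, finsetSum_coeff, coeff_C_mul, coeff_X_pow]
  rcases hm'.eq_or_lt with h | h
  · subst h
    have h1 := hm.coeff_natDegree
    rw [hd] at h1
    rw [h1]
    simp
  · rw [coeff_eq_zero_of_natDegree_lt (by omega), Finset.sum_eq_zero]
    · simp
    · intro i hi
      have := Finset.mem_range.1 hi
      rw [if_neg (by omega)]
      simp

theorem statement4
    (p : ℕ) (hp : p.Prime) (hp2 : p ≠ 2)
    (v : ℕ) (hv1 : 1 ≤ v) (hv2 : v ≤ p - 1)
    (hv : orderOf (v : ZMod p) = p - 1)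
    (vn : ℤ → ℕ)
    (hvn1 : ∀ n : ℤ, 1 ≤ vn n) (hvn2 : ∀ n : ℤ, vn n ≤ p - 1)
    (hvn0 : vn 0 = 1)
    (hvnrec : ∀ n : ℤ, (vn (n + 1) : ZMod p) = (v : ZMod p) * (vn n : ZMod p))
    :
    ((∑ i ∈ Finset.range (p - 1), Polynomial.C ((vn (-(i : ℤ)) : ZMod p)) * Polynomial.X ^ i :
        Polynomial (ZMod p)) =
      Polynomial.C ((vn (-((p - 2 : ℕ) : ℤ)) : ZMod p)) *
        ∏ k ∈ (Finset.range (p - 1)).erase 1,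
          (Polynomial.X - Polynomial.C ((vn (k : ℤ) : ZMod p))))
    ∧
    ∃ R : Polynomial ℤ, R.degree < ((p - 2 : ℕ) : WithBot ℕ) ∧
      (∑ i ∈ Finset.range (p - 1), Polynomial.C ((vn (-(i : ℤ)) : ℤ)) * Polynomial.X ^ i :
          Polynomial ℤ) =
        Polynomial.C ((vn (-((p - 2 : ℕ) : ℤ)) : ℤ)) *
          ∏ k ∈ (Finset.range (p - 1)).erase 1,
            (Polynomial.X - Polynomial.C ((vn (k : ℤ) : ℤ)))
        + Polynomial.C (p : ℤ) * R := by
  haveI : Fact p.Prime := ⟨hp⟩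
  have hp3 : 3 ≤ p := by
    have := hp.two_le
    omega
  obtain ⟨n, rfl⟩ : ∃ n, p = n + 2 := ⟨p - 2, by omega⟩
  have e1 : n + 2 - 1 = n + 1 := by omega
  have e2 : n + 2 - 2 = n := by omega
  rw [e1] at hv ⊢
  rw [e2]
  set w : ZMod (n + 2) := (v : ZMod (n + 2)) with hw
  have hw1 : w ^ (n + 1) = 1 := by rw [← hv]; exact pow_orderOf_eq_one w
  have hw0 : w ≠ 0 := by
    intro h
    rw [h] at hw1
    simp at hw1
  have hz : ∀ m : ℤ, (vn m : ZMod (n + 2)) = w ^ m := by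
    intro m
    induction m using Int.induction_on with
    | zero => simp [hvn0]
    | succ i ih => rw [hvnrec, ih, zpow_add_one₀ hw0, mul_comm]
    | pred i ih =>
      have := hvnrec (-(i : ℤ) - 1)
      rw [sub_add_cancel, ih] at this
      rw [zpow_sub_one₀ hw0, this]
      field_simp
  have hcard : ((Finset.range (n + 1)).erase 1).card = n := by
    rw [Finset.card_erase_of_mem (by simp; omega)]
    simp
  have hinj : Set.InjOn (fun k : ℕ => w ^ k) (Finset.range (n + 1) : Finset ℕ) := by
    intro a ha b hb hab
    simp only [Finset.coe_range, Set.mem_Iio] at ha hb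
    exact pow_injOn_Iio_orderOf (by simpa [hv] using ha) (by simpa [hv] using hb) hab
  have first : (∑ i ∈ Finset.range (n + 1),
        Polynomial.C ((vn (-(i : ℤ)) : ZMod (n + 2))) * Polynomial.X ^ i :
        Polynomial (ZMod (n + 2))) =
      Polynomial.C ((vn (-(n : ℤ)) : ZMod (n + 2))) *
        ∏ k ∈ (Finset.range (n + 1)).erase 1,
          (Polynomial.X - Polynomial.C ((vn (k : ℤ) : ZMod (n + 2)))) := by
    have hd := aux_deg (fun i : ℕ => (vn (-(i : ℤ)) : ZMod (n + 2)))
      (fun i : ℕ => (vn (i : ℤ) : ZMod (n + 2))) n _ hcard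
    refine Polynomial.eq_of_degree_sub_lt_of_eval_index_eq (v := fun k : ℕ => w ^ k)
      ((Finset.range (n + 1)).erase 1)
      (hinj.mono (by exact_mod_cast Finset.erase_subset _ _)) (by rw [hcard]; exact hd) ?_
    intro k hk
    have hr : Polynomial.eval (w ^ k) (∏ k ∈ (Finset.range (n + 1)).erase 1,
          (Polynomial.X - Polynomial.C ((vn (k : ℤ) : ZMod (n + 2))))) = 0 := by
      rw [Polynomial.eval_prod]
      apply Finset.prod_eq_zero hk
      simp [hz]
    rw [eval_mul, hr, mul_zero, eval_finsetSum]
    have hs : ∀ i ∈ Finset.range (n + 1), Polynomial.eval (w ^ k)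
        (Polynomial.C ((vn (-(i : ℤ)) : ZMod (n + 2))) * Polynomial.X ^ i) = (w⁻¹ * w ^ k) ^ i := by
      intro i _
      rw [hz]
      simp [mul_pow]
    rw [Finset.sum_congr rfl hs]
    have hne : w⁻¹ * w ^ k - 1 ≠ 0 := by
      intro h
      have h2 : w ^ k = w ^ 1 := by
        have := sub_eq_zero.1 h
        field_simp at this
        simpa using this
      have hk' := Finset.mem_erase.1 hk
      exact hk'.1 (hinj (by exact_mod_cast hk'.2) (by simp; omega) h2)
    have hg := mul_geom_sum (w⁻¹ * w ^ k) (n + 1)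
    rw [mul_pow, ← pow_mul, mul_comm k, pow_mul, inv_pow, hw1] at hg
    simp only [inv_one, one_pow, mul_one, sub_self] at hg
    exact (mul_eq_zero.1 hg).resolve_left hne
  refine ⟨first, ?_⟩
  have hd := aux_deg (fun i : ℕ => (vn (-(i : ℤ)) : ℤ)) (fun i : ℕ => (vn (i : ℤ) : ℤ)) n _ hcard
  have hmap := sub_eq_zero.2 first
  have hdvd : Polynomial.C ((n + 2 : ℕ) : ℤ) ∣
      (∑ i ∈ Finset.range (n + 1), Polynomial.C ((vn (-(i : ℤ)) : ℤ)) * Polynomial.X ^ i -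
        Polynomial.C ((vn (-(n : ℤ)) : ℤ)) * ∏ k ∈ (Finset.range (n + 1)).erase 1,
            (Polynomial.X - Polynomial.C ((vn (k : ℤ) : ℤ))) : Polynomial ℤ) := by
    rw [Polynomial.C_dvd_iff_dvd_coeff]
    intro i
    rw [← ZMod.intCast_zmod_eq_zero_iff_dvd, ← eq_intCast (Int.castRingHom (ZMod (n + 2))), ← Polynomial.coeff_map]
    have : ∀ q : Polynomial (ZMod (n + 2)), q = 0 → q.coeff i = 0 := by
      intro q hq
      rw [hq, coeff_zero]
    apply this
    rw [← hmap]
    simp only [Polynomial.map_sub, Polynomial.map_mul, Polynomial.map_sum, Polynomial.map_prod,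
      Polynomial.map_pow, Polynomial.map_X, Polynomial.map_C, eq_intCast (Int.castRingHom (ZMod (n + 2))), Int.cast_natCast]
  obtain ⟨R, hR⟩ := hdvd
  refine ⟨R, ?_, ?_⟩
  · rw [hR, degree_C_mul (by positivity)] at hd
    exact hd
  · rw [← hR]
    ring
end

section
/- For each i with 1 ≤ i ≤ p−2, the quantity δ_i = (v_{-(i-1)} − v·v_{-i})/p is an integer satisfying −p < δ_i ≤ 0, the quantity δ_0 = (v_{-(p-2)} − v)/p equals 0, and in ℤ[X] one has the identity P(X)·(X − v) = p·Q(X) + v·(X^{p-1} − 1), where Q(X) = Σ_{i=1}^{p-2} δ_i·X^i. -/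
open Finset Polynomial

theorem aux_poly (p v : ℤ) (a δ : ℕ → ℤ) (h : ∀ i, p * δ (i+1) = a i - v * a (i+1)) (n : ℕ) :
    (∑ i ∈ Finset.range (n+1), C (a i) * X ^ i : Polynomial ℤ) * (X - C v) =
      C p * (∑ i ∈ Finset.Icc 1 n, C (δ i) * X ^ i) + C (a n) * X ^ (n+1) - C v * C (a 0) := by
  induction n with
  | zero => simp; ring
  | succ n ih =>
    rw [Finset.sum_range_succ, add_mul, ih, Finset.sum_Icc_succ_top (by omega)]
    have h2 : (C p * C (δ (n+1)) : Polynomial ℤ) = C (a n) - C v * C (a (n+1)) := by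
      rw [← C_mul, h, C_sub, C_mul]
    linear_combination (-X^(n+1)) * h2

theorem statement5
    (p : ℕ) (hp : p.Prime) (hp2 : p ≠ 2)
    (v : ℕ) (hv1 : 1 ≤ v) (hv2 : v ≤ p - 1)
    (hv : orderOf (v : ZMod p) = p - 1)
    (vn : ℤ → ℕ)
    (hvn1 : ∀ n : ℤ, 1 ≤ vn n) (hvn2 : ∀ n : ℤ, vn n ≤ p - 1)
    (hvn0 : vn 0 = 1)
    (hvnrec : ∀ n : ℤ, (vn (n + 1) : ZMod p) = (v : ZMod p) * (vn n : ZMod p))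
    :
    ∃ δ : ℕ → ℤ,
      (∀ i : ℕ, (p : ℤ) * δ i = (vn (1 - (i : ℤ)) : ℤ) - (v : ℤ) * (vn (-(i : ℤ)) : ℤ))
      ∧ (∀ i : ℕ, 1 ≤ i → i ≤ p - 2 → -(p : ℤ) < δ i ∧ δ i ≤ 0)
      ∧ δ 0 = 0
      ∧ (∑ i ∈ Finset.range (p - 1), Polynomial.C ((vn (-(i : ℤ)) : ℤ)) * Polynomial.X ^ i :
            Polynomial ℤ) * (Polynomial.X - Polynomial.C (v : ℤ)) =
          Polynomial.C (p : ℤ) *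
            (∑ i ∈ Finset.Icc 1 (p - 2), Polynomial.C (δ i) * Polynomial.X ^ i)
          + Polynomial.C (v : ℤ) * (Polynomial.X ^ (p - 1) - 1) := by
  haveI := Fact.mk hp
  have hp3 : 2 < p := lt_of_le_of_ne hp.two_le (Ne.symm hp2)
  have inj : ∀ a b : ℕ, a ≤ p - 1 → b ≤ p - 1 → (a : ZMod p) = b → a = b := by
    intro a b ha hb hab
    rw [ZMod.natCast_eq_natCast_iff] at hab
    exact Nat.ModEq.eq_of_lt_of_lt hab (by omega) (by omega)
  have hpow : ∀ k : ℕ, (v : ZMod p) ^ k * (vn (-(k : ℤ)) : ZMod p) = 1 := by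
    intro k
    induction k with
    | zero => simp [hvn0]
    | succ k ih =>
      have := hvnrec (-((k + 1 : ℕ) : ℤ))
      rw [show (-((k + 1 : ℕ) : ℤ)) + 1 = -(k : ℤ) by push_cast; ring] at this
      rw [pow_succ, mul_assoc, ← this, ih]
  have hlast : vn (-((p - 2 : ℕ) : ℤ)) = v := by
    apply inj _ _ (hvn2 _) hv2
    have h1 := hpow (p - 2)
    have h2 : (v : ZMod p) ^ (p - 2) * (v : ZMod p) = 1 := by
      rw [← pow_succ, show p - 2 + 1 = p - 1 by omega, ← hv, pow_orderOf_eq_one]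
    have h3 : (v : ZMod p) ^ (p - 2) ≠ 0 := left_ne_zero_of_mul_eq_one h2
    exact mul_left_cancel₀ h3 (h1.trans h2.symm)
  have hone : vn 1 = v := by
    apply inj _ _ (hvn2 _) hv2
    have := hvnrec 0
    simpa [hvn0] using this
  have hdvd : ∀ i : ℕ, (p : ℤ) ∣ (vn (1 - (i : ℤ)) : ℤ) - (v : ℤ) * (vn (-(i : ℤ)) : ℤ) := by
    intro i
    rw [← ZMod.intCast_zmod_eq_zero_iff_dvd]
    have := hvnrec (-(i : ℤ))
    rw [show -(i : ℤ) + 1 = 1 - i by ring] at this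
    push_cast
    rw [this, sub_self]
  choose δ hδ using hdvd
  have hpz : (2 : ℤ) < p := by exact_mod_cast hp3
  refine ⟨δ, fun i => (hδ i).symm, ?_, ?_, ?_⟩
  · intro i _ _
    have h := hδ i
    have a1 : (1 : ℤ) ≤ vn (1 - (i : ℤ)) := by exact_mod_cast hvn1 _
    have b1 : (1 : ℤ) ≤ vn (-(i : ℤ)) := by exact_mod_cast hvn1 _
    have a2 : (vn (1 - (i : ℤ)) : ℤ) ≤ p - 1 := by have := hvn2 (1 - (i : ℤ)); omega
    have b2 : (vn (-(i : ℤ)) : ℤ) ≤ p - 1 := by have := hvn2 (-(i : ℤ)); omega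
    have v1 : (1 : ℤ) ≤ v := by exact_mod_cast hv1
    have v2 : (v : ℤ) ≤ p - 1 := by omega
    generalize (vn (1 - (i : ℤ)) : ℤ) = a at *
    generalize (vn (-(i : ℤ)) : ℤ) = b at *
    have hb : (v : ℤ) * b ≤ (p - 1) * (p - 1) := by gcongr; omega
    have hb' : 1 ≤ (v : ℤ) * b := by nlinarith
    constructor
    · by_contra hc
      nlinarith
    · by_contra hc
      nlinarith
  · have h := hδ 0
    simp [hone, hvn0] at h
    omega
  · have := aux_poly p v (fun i => (vn (-(i : ℤ)) : ℤ)) δ (fun i => by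
      rw [← hδ (i+1)]
      simp) (p - 2)
    rw [show p - 2 + 1 = p - 1 by omega] at this
    rw [this]
    simp only [hlast]
    simp [hvn0]
    ring
end

section
/- Suppose p ≡ 3 (mod 4) and p ≠ 3. If h is an odd prime dividing the class number of the imaginary quadratic field ℚ(√−p), then Σ_{i=0}^{p-2} (−1)^i·v_{-i} ≡ 0 (mod h). -/
section partA
open Filter Topology HurwitzZeta

theorem aux_bound_le {c m M s : ℝ} (hc : 0 < c) (hc1 : c < 1) (hm : c ≤ m) (hmM : m ≤ M)
    (hM : M ≤ m + 1) (hs1 : 1 < s) (hs2 : s ≤ 2) :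
    |m ^ (-s) - M ^ (-s)| ≤ 2 / c * (1 / m ^ 2) := by
  have hm0 : 0 < m := hc.trans_le hm
  have hM0 : 0 < M := hm0.trans_le hmM
  have h1 : M ^ (-s) = m ^ (-s) * (m / M) ^ s := by
    rw [Real.div_rpow hm0.le hM0.le, Real.rpow_neg hm0.le, Real.rpow_neg hM0.le]
    have : m ^ s ≠ 0 := (Real.rpow_pos_of_pos hm0 s).ne'
    field_simp
  have hr1 : m / M ≤ 1 := (div_le_one hM0).2 hmM
  have hr0 : 0 < m / M := div_pos hm0 hM0
  have h2 : (m / M) ^ (2:ℕ) ≤ (m / M) ^ s := by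
    rw [← Real.rpow_natCast]
    exact Real.rpow_le_rpow_of_exponent_ge hr0 hr1 (by simpa using hs2)
  have h2' : (m / M) ^ s ≤ 1 := Real.rpow_le_one hr0.le hr1 (by linarith)
  have h3 : m ^ (-s) ≤ 1 / c * (1 / m) := by
    have : m ^ (-s) = m ^ (-(s-1)) * m⁻¹ := by
      rw [← Real.rpow_neg_one m, ← Real.rpow_add hm0]; congr 1; ring
    rw [this, ← one_div m]
    refine mul_le_mul_of_nonneg_right ?_ (by positivity)
    calc m ^ (-(s-1)) ≤ c ^ (-(s-1)) := Real.rpow_le_rpow_of_nonpos hc hm (by linarith)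
      _ ≤ c ^ (-1:ℝ) := Real.rpow_le_rpow_of_exponent_ge hc hc1.le (by linarith)
      _ = 1 / c := by rw [Real.rpow_neg_one, one_div]
  have h4 : 1 - (m / M) ^ s ≤ 2 * (1 / m) := by
    have : 1 - (m / M) ^ 2 ≤ 2 * (1 / m) := by
      have e : 1 - m / M = (M - m) / M := by field_simp
      have e2 : 1 - m / M ≤ 1 / m := by
        rw [e, div_le_div_iff₀ hM0 hm0]
        nlinarith
      nlinarith [hr0, hr1]
    linarith
  have h5 : 0 ≤ m ^ (-s) := Real.rpow_nonneg hm0.le _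
  rw [h1, show m ^ (-s) - m ^ (-s) * (m / M) ^ s = m ^ (-s) * (1 - (m / M) ^ s) by ring,
    abs_of_nonneg (mul_nonneg h5 (by linarith))]
  calc _ ≤ (1 / c * (1 / m)) * (2 * (1 / m)) := by
        apply mul_le_mul h3 h4 (by linarith) (by positivity)
    _ = _ := by field_simp

theorem aux_norm_term {x y : ℝ} (hx : 0 < x) (hy : 0 < y) (s : ℝ) :
    ‖(1 / (x:ℂ) ^ (s:ℂ) - 1 / (y:ℂ) ^ (s:ℂ)) / 2‖ = |x ^ (-s) - y ^ (-s)| / 2 := by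
  have : (1 / (x:ℂ) ^ (s:ℂ) - 1 / (y:ℂ) ^ (s:ℂ)) / 2 = (((x ^ (-s) - y ^ (-s)) / 2 : ℝ) : ℂ) := by
    push_cast
    rw [Complex.ofReal_cpow hx.le, Complex.ofReal_cpow hy.le]
    simp [Complex.cpow_neg]
  rw [this, Complex.norm_real, Real.norm_eq_abs, abs_div]; simp

theorem hurwitzOdd_one {a : ℝ} (ha0 : 0 < a) (ha1 : a < 1) :
    hurwitzZetaOdd (a : UnitAddCircle) 1 = Real.pi / 2 * Complex.cot (Real.pi * a) := by
  set c := min a (1 - a) with hcdef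
  have hc : 0 < c := lt_min ha0 (by linarith)
  have hc1 : c < 1 := (min_le_left _ _).trans_lt ha1
  have hca : c ≤ a := min_le_left _ _
  have hca' : c ≤ 1 - a := min_le_right _ _
  set bound : ℕ → ℝ := fun n => 2 / c * (1 / ((n:ℝ) + c) ^ 2) with hbdef
  have hbs : Summable bound := by
    apply Summable.mul_left
    have := (Real.summable_one_div_nat_add_rpow c 2).2 (by norm_num)
    refine this.congr fun n => ?_
    have : (0:ℝ) < n + c := by positivity
    rw [abs_of_pos this]; norm_num
  have hb : ∀ n : ℕ, ∀ s : ℝ, 1 < s → s ≤ 2 →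
      ‖(1 / (n + a : ℂ) ^ (s:ℂ) - 1 / (n + 1 - a : ℂ) ^ (s:ℂ)) / 2‖ ≤ bound n := by
    intro n s hs1 hs2
    have hn : (0:ℝ) ≤ n := Nat.cast_nonneg n
    have e := aux_norm_term (x := n + a) (y := n + 1 - a) (by linarith) (by linarith) s
    push_cast at e
    rw [e]
    have key : |((n:ℝ) + a) ^ (-s) - ((n:ℝ) + 1 - a) ^ (-s)| ≤ bound n := by
      rcases le_total ((n:ℝ) + a) (n + 1 - a) with h | h
      · refine (aux_bound_le hc hc1 (by linarith) h (by linarith) hs1 hs2).trans ?_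
        simp only [hbdef]
        gcongr
      · rw [abs_sub_comm]
        refine (aux_bound_le hc hc1 (by linarith) h (by linarith) hs1 hs2).trans ?_
        simp only [hbdef]
        gcongr
        linarith
    have := abs_nonneg (((n:ℝ) + a) ^ (-s) - ((n:ℝ) + 1 - a) ^ (-s))
    linarith
  have hlim : ∀ n : ℕ, Tendsto (fun s : ℝ => (1 / (n + a : ℂ) ^ (s:ℂ) - 1 / (n + 1 - a : ℂ) ^ (s:ℂ)) / 2)
      (𝓝[>] 1) (𝓝 ((1 / (n + a : ℂ) - 1 / (n + 1 - a : ℂ)) / 2)) := by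
    intro n
    have hn : (0:ℝ) ≤ n := Nat.cast_nonneg n
    have h1 : (n + a : ℂ) ≠ 0 := by
      have : (n:ℝ) + a ≠ 0 := by linarith
      exact_mod_cast this
    have h2 : (n + 1 - a : ℂ) ≠ 0 := by
      have : (n:ℝ) + 1 - a ≠ 0 := by linarith
      exact_mod_cast this
    have hcont : ContinuousAt (fun s : ℝ => (1 / (n + a : ℂ) ^ (s:ℂ) - 1 / (n + 1 - a : ℂ) ^ (s:ℂ)) / 2) 1 := by
      have g1 : ContinuousAt (fun s : ℝ => (n + a : ℂ) ^ (s:ℂ)) 1 :=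
        (Complex.continuous_ofReal.continuousAt).const_cpow (Or.inl h1)
      have g2 : ContinuousAt (fun s : ℝ => (n + 1 - a : ℂ) ^ (s:ℂ)) 1 :=
        (Complex.continuous_ofReal.continuousAt).const_cpow (Or.inl h2)
      exact ((continuousAt_const.div g1 (by simp [h1])).sub
        (continuousAt_const.div g2 (by simp [h2]))).div_const _
    have := hcont.tendsto
    simp only [Complex.ofReal_one, Complex.cpow_one] at this
    exact this.mono_left nhdsWithin_le_nhds
  have hev : ∀ᶠ s : ℝ in 𝓝[>] 1, 1 < s ∧ s ≤ 2 := by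
    have : Set.Ioc (1:ℝ) 2 ∈ 𝓝[>] (1:ℝ) := Ioc_mem_nhdsGT (by norm_num)
    filter_upwards [this] with s hs using hs
  have T1 := tendsto_tsum_of_dominated_convergence hbs hlim
    (by filter_upwards [hev] with s hs n using hb n s hs.1 hs.2)
  have T2 : Tendsto (fun s : ℝ => ∑' n : ℕ, (1 / (n + a : ℂ) ^ (s:ℂ) - 1 / (n + 1 - a : ℂ) ^ (s:ℂ)) / 2)
      (𝓝[>] 1) (𝓝 (hurwitzZetaOdd (a : UnitAddCircle) 1)) := by
    have hc : Tendsto (fun s : ℝ => hurwitzZetaOdd (a : UnitAddCircle) (s:ℂ)) (𝓝[>] 1)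
        (𝓝 (hurwitzZetaOdd (a : UnitAddCircle) 1)) := by
      have := ((differentiable_hurwitzZetaOdd (a : UnitAddCircle)).continuous.comp
        Complex.continuous_ofReal).tendsto 1
      simp only [Function.comp, Complex.ofReal_one] at this
      exact this.mono_left nhdsWithin_le_nhds
    refine hc.congr' ?_
    filter_upwards [hev] with s hs
    exact (hasSum_nat_hurwitzZetaOdd_of_mem_Icc ⟨ha0.le, ha1.le⟩ (by simpa using hs.1)).tsum_eq.symm
  have E1 := tendsto_nhds_unique T2 T1
  rw [E1]
  have hsum : Summable (fun n : ℕ => ((1 / (n + a : ℂ) - 1 / (n + 1 - a : ℂ)) / 2)) := by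
    refine Summable.of_norm_bounded hbs fun n => ?_
    refine le_of_tendsto (hlim n).norm ?_
    filter_upwards [hev] with s hs using hb n s hs.1 hs.2
  have hint : (a:ℂ) ∈ Complex.integerComplement := by
    rw [Complex.mem_integerComplement_iff]
    rintro ⟨n, hn⟩
    have hn' : (n:ℝ) = a := by exact_mod_cast hn
    have h1 : (0:ℝ) < n := by linarith
    have h2 : (n:ℝ) < 1 := by linarith
    have h1' : 0 < n := by exact_mod_cast h1
    have h2' : n < 1 := by exact_mod_cast h2
    omega
  have C := cot_series_rep' hint
  have hCs : Summable (fun n : ℕ => (1 / ((a:ℂ) - (n+1)) + 1 / ((a:ℂ) + (n+1)))) := by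
    exact Summable_cotTerm hint
  have t1 := hsum.hasSum.tendsto_sum_nat
  have t2 := hCs.hasSum.tendsto_sum_nat
  rw [← C] at t2
  have hfin : ∀ N : ℕ, ∑ n ∈ Finset.range N, ((1 / (n + a : ℂ) - 1 / (n + 1 - a : ℂ)) / 2) =
      (1/2) * (1 / (a:ℂ) + ∑ n ∈ Finset.range N, (1 / ((a:ℂ) - (n+1)) + 1 / ((a:ℂ) + (n+1)))
        - 1 / ((N:ℂ) + a)) := by
    intro N
    induction N with
    | zero => simp
    | succ N ih =>
      rw [Finset.sum_range_succ, ih, Finset.sum_range_succ]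
      push_cast
      have : 1 / ((a:ℂ) - (N + 1)) = - (1 / (N + 1 - a : ℂ)) := by
        rw [← neg_sub, one_div, one_div, inv_neg]
      rw [this, show (a:ℂ) + (N + 1) = N + 1 + a by ring]
      ring
  have t3 : Tendsto (fun N : ℕ => 1 / ((N:ℂ) + a)) atTop (𝓝 0) := by
    have : Tendsto (fun N : ℕ => 1 / ((N:ℝ) + a)) atTop (𝓝 0) := by
      simp only [one_div]
      exact tendsto_inv_atTop_zero.comp (tendsto_atTop_add_const_right _ _ tendsto_natCast_atTop_atTop)
    have := (Complex.continuous_ofReal.tendsto 0).comp this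
    simpa [Function.comp_def] using this
  have t4 := ((t2.const_add (1 / (a:ℂ))).sub t3).const_mul (1/2)
  have := tendsto_nhds_unique t1 (t4.congr fun N => (hfin N).symm)
  rw [this]; ring

noncomputable def chi (p : ℕ) [Fact p.Prime] : DirichletCharacter ℂ p :=
  (quadraticChar (ZMod p)).ringHomComp (Int.castRingHom ℂ)

theorem chi_apply (p : ℕ) [Fact p.Prime] (a : ZMod p) :
    chi p a = ((quadraticChar (ZMod p) a : ℤ) : ℂ) := rfl

theorem chi_isQuadratic (p : ℕ) [Fact p.Prime] : (chi p).IsQuadratic :=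
  (quadraticChar_isQuadratic (ZMod p)).comp _

theorem chi_neg_one (p : ℕ) [Fact p.Prime] (hp3 : p % 4 = 3) : chi p (-1) = -1 := by
  have h2 : ringChar (ZMod p) ≠ 2 := by
    rw [ZMod.ringChar_zmod_n]; omega
  rw [chi_apply, quadraticChar_neg_one h2, ZMod.card, ZMod.χ₄_nat_three_mod_four hp3]
  simp

theorem chi_ne_one (p : ℕ) [Fact p.Prime] (hp3 : p % 4 = 3) : chi p ≠ 1 := by
  intro h
  have := chi_neg_one p hp3
  rw [h, MulChar.one_apply isUnit_one.neg] at this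
  norm_num at this

theorem chi_odd (p : ℕ) [Fact p.Prime] (hp3 : p % 4 = 3) : Function.Odd (chi p) := by
  intro x
  rw [← neg_one_mul, map_mul, chi_neg_one p hp3, neg_one_mul]

noncomputable def SS (p : ℕ) [Fact p.Prime] : ℤ :=
  ∑ j : ZMod p, (j.val : ℤ) * quadraticChar (ZMod p) j

theorem geom_aux (z : ℂ) (n : ℕ) :
    (∑ k ∈ Finset.range n, (k:ℂ) * z ^ k) * (z - 1) = n * z ^ n - z * ∑ k ∈ Finset.range n, z ^ k := by
  induction n with
  | zero => simp
  | succ n ih =>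
    rw [Finset.sum_range_succ, add_mul, ih, Finset.sum_range_succ]
    push_cast
    ring

theorem sum_zmod_val {M : Type*} [AddCommMonoid M] (p : ℕ) [NeZero p] (f : ℕ → M) :
    ∑ k : ZMod p, f k.val = ∑ k ∈ Finset.range p, f k := by
  refine Finset.sum_nbij' (fun k => k.val) (fun n => (n : ZMod p)) ?_ ?_ ?_ ?_ ?_
  · intro a _; exact Finset.mem_range.2 (ZMod.val_lt a)
  · intro a _; exact Finset.mem_univ _
  · intro a _; exact ZMod.natCast_zmod_val a
  · intro a ha; exact ZMod.val_cast_of_lt (Finset.mem_range.1 ha)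
  · intro a _; rfl

theorem geom_sum_val (p : ℕ) [Fact p.Prime] (a : ZMod p) (ha : a ≠ 0) :
    ∑ k : ZMod p, (k.val : ℂ) * ZMod.stdAddChar (k * a) = p / (ZMod.stdAddChar a - 1) := by
  have hz1 : ZMod.stdAddChar a ≠ 1 := by
    intro h
    apply ha
    apply ZMod.injective_stdAddChar
    rw [h, AddChar.map_zero_eq_one]
  have hzp : (ZMod.stdAddChar a) ^ p = 1 := by
    rw [← AddChar.map_nsmul_eq_pow]; simp
  have e : ∑ k : ZMod p, (k.val : ℂ) * ZMod.stdAddChar (k * a) =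
      ∑ k ∈ Finset.range p, (k : ℂ) * (ZMod.stdAddChar a) ^ k := by
    rw [← sum_zmod_val p (fun k => (k : ℂ) * (ZMod.stdAddChar a) ^ k)]
    refine Finset.sum_congr rfl fun k _ => ?_
    rw [← AddChar.map_nsmul_eq_pow, nsmul_eq_mul, ZMod.natCast_zmod_val]
  have hg := geom_aux (ZMod.stdAddChar a) p
  rw [hzp, geom_sum_eq hz1, hzp] at hg
  rw [e, eq_div_iff (sub_ne_zero.2 hz1), hg]
  simp

theorem std_cot (p : ℕ) [Fact p.Prime] (a : ZMod p) (ha : a ≠ 0) :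
    1 / (ZMod.stdAddChar a - 1) =
      (-1 / 2 - Complex.I / 2 * Complex.cot (Real.pi * ((a.val : ℝ) / (p : ℝ) : ℝ)) : ℂ) := by
  have hz1 : ZMod.stdAddChar a ≠ 1 := by
    intro h
    apply ha
    apply ZMod.injective_stdAddChar
    rw [h, AddChar.map_zero_eq_one]
  have hz : Complex.exp (2 * Complex.I * (Real.pi * ((a.val : ℝ) / (p : ℝ) : ℝ))) = ZMod.stdAddChar a := by
    have := ZMod.stdAddChar_coe (N := p) (a.val : ℤ)
    rw [Int.cast_natCast, ZMod.natCast_zmod_val] at this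
    rw [this]
    congr 1
    push_cast
    ring
  rw [Complex.cot_eq_exp_ratio, hz]
  have h1 : ZMod.stdAddChar a - 1 ≠ 0 := sub_ne_zero.2 hz1
  have h2 : 1 - ZMod.stdAddChar a ≠ 0 := sub_ne_zero.2 hz1.symm
  have hI := Complex.I_ne_zero
  field_simp
  ring

theorem chi_zero (p : ℕ) [Fact p.Prime] : chi p 0 = 0 := by simp [chi_apply]

theorem gauss_chi (p : ℕ) [Fact p.Prime] (k : ZMod p) (hk : k ≠ 0) :
    ∑ a : ZMod p, chi p a * ZMod.stdAddChar (k * a) = chi p k * gaussSum (chi p) ZMod.stdAddChar := by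
  have h := gaussSum_mulShift (chi p) ZMod.stdAddChar (Units.mk0 k hk)
  rw [Units.val_mk0] at h
  have hsq : chi p k * chi p k = 1 := by
    rw [← map_mul, ← pow_two, chi_apply, quadraticChar_sq_one' hk]; simp
  rw [← h, ← mul_assoc, hsq, one_mul]
  rfl

theorem cot_sum (p : ℕ) [Fact p.Prime] (hp3 : p % 4 = 3) :
    (p : ℂ) * (-(Complex.I / 2) * ∑ a : ZMod p, chi p a * Complex.cot (Real.pi * ((a.val : ℝ) / (p : ℝ) : ℝ)))
      = (SS p : ℂ) * gaussSum (chi p) ZMod.stdAddChar := by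
  have h1 : ∑ a : ZMod p, chi p a * ∑ k : ZMod p, (k.val : ℂ) * ZMod.stdAddChar (k * a) =
      (SS p : ℂ) * gaussSum (chi p) ZMod.stdAddChar := by
    simp_rw [Finset.mul_sum]
    rw [Finset.sum_comm, SS, Int.cast_sum, Finset.sum_mul]
    refine Finset.sum_congr rfl fun k _ => ?_
    by_cases hk : k = 0
    · simp [hk]
    push_cast
    rw [← chi_apply, mul_assoc, ← gauss_chi p k hk, Finset.mul_sum]
    refine Finset.sum_congr rfl fun a _ => ?_
    ring
  rw [← h1]
  have h2 : ∀ a : ZMod p, chi p a * ∑ k : ZMod p, (k.val : ℂ) * ZMod.stdAddChar (k * a) =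
      (p : ℂ) * (chi p a * (-1/2) + -(Complex.I / 2) * (chi p a * Complex.cot (Real.pi * ((a.val : ℝ) / (p : ℝ) : ℝ)))) := by
    intro a
    by_cases ha : a = 0
    · rw [ha, chi_zero]; ring
    rw [geom_sum_val p a ha, div_eq_mul_one_div, std_cot p a ha]
    ring
  simp_rw [h2]
  rw [← Finset.mul_sum, Finset.sum_add_distrib, ← Finset.sum_mul,
    MulChar.sum_eq_zero_of_ne_one (chi_ne_one p hp3), ← Finset.mul_sum]
  ring

theorem L_one_sq (p : ℕ) [Fact p.Prime] (hp3 : p % 4 = 3) :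
    (DirichletCharacter.LFunction (chi p) 1) ^ 2 = Real.pi ^ 2 * (SS p : ℂ) ^ 2 / p ^ 3 := by
  have hp0 : (p : ℂ) ≠ 0 := by exact_mod_cast (Fact.out : p.Prime).ne_zero
  have hL : DirichletCharacter.LFunction (chi p) 1 =
      (p : ℂ)⁻¹ * (Real.pi / 2 * ∑ a : ZMod p, chi p a * Complex.cot (Real.pi * ((a.val : ℝ) / (p : ℝ) : ℝ))) := by
    rw [DirichletCharacter.LFunction, ZMod.LFunction_def_odd (chi_odd p hp3), Complex.cpow_neg_one]
    congr 1
    rw [Finset.mul_sum]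
    refine Finset.sum_congr rfl fun a _ => ?_
    by_cases ha : a = 0
    · rw [ha, chi_zero]; ring
    have hpR : (0:ℝ) < p := by exact_mod_cast (Fact.out : p.Prime).pos
    have h0 : (0:ℝ) < (a.val : ℝ) / p := by
      apply div_pos _ hpR
      have : a.val ≠ 0 := by rwa [Ne, ZMod.val_eq_zero]
      exact_mod_cast Nat.pos_of_ne_zero this
    have h1 : (a.val : ℝ) / p < 1 := by
      rw [div_lt_one hpR]
      exact_mod_cast ZMod.val_lt a
    rw [ZMod.toAddCircle_apply, hurwitzOdd_one h0 h1]
    ring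
  have hc := cot_sum p hp3
  have hg := gaussSum_sq (chi_ne_one p hp3) (chi_isQuadratic p) (ZMod.isPrimitive_stdAddChar p)
  rw [chi_neg_one p hp3, ZMod.card] at hg
  rw [hL]
  set C := ∑ a : ZMod p, chi p a * Complex.cot (Real.pi * ((a.val : ℝ) / (p : ℝ) : ℝ))
  have h2 : (p : ℂ) ^ 2 * C ^ 2 = 4 * p * (SS p : ℂ) ^ 2 := by
    have h3 : ((p : ℂ) * (-(Complex.I / 2) * C)) ^ 2 = (SS p : ℂ) ^ 2 * (-1 * p) := by
      rw [hc, mul_pow, hg]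
    have : ((p : ℂ) * (-(Complex.I / 2) * C)) ^ 2 = Complex.I ^ 2 * (p : ℂ) ^ 2 * C ^ 2 / 4 := by ring
    rw [this, Complex.I_sq] at h3
    linear_combination (-4) * h3
  have h4 : (p : ℂ) * C ^ 2 = 4 * (SS p : ℂ) ^ 2 := by
    apply mul_left_cancel₀ hp0
    linear_combination h2
  field_simp
  linear_combination h4

end partA

section partC
open NumberField

noncomputable def aI (F : Type*) [Field F] [NumberField F] (n : ℕ) : ℕ :=
  Nat.card {I : Ideal (𝓞 F) // Ideal.absNorm I = n}

theorem absNorm_nat (F : Type*) [Field F] [NumberField F] (n : ℕ) :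
    Ideal.absNorm (Ideal.span {(n : 𝓞 F)}) = n ^ Module.finrank ℚ F := by
  rw [Ideal.absNorm_span_singleton]
  have : (n : 𝓞 F) = algebraMap ℤ (𝓞 F) n := by simp
  rw [this, Algebra.norm_algebraMap, RingOfIntegers.rank, Int.natAbs_pow]
  simp

theorem sup_coprime_top {R : Type*} [CommRing R] {m n : ℕ} (h : m.Coprime n) {J K : Ideal R}
    (hm : (m : R) ∈ J) (hn : (n : R) ∈ K) : J ⊔ K = ⊤ := by
  rw [Ideal.eq_top_iff_one]
  have hb : (m.gcd n : ℤ) = m * m.gcdA n + n * m.gcdB n := Nat.gcd_eq_gcd_ab m n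
  rw [h] at hb
  have hb' : (1 : R) = m * (m.gcdA n : ℤ) + n * (m.gcdB n : ℤ) := by
    have := congrArg (Int.cast : ℤ → R) hb
    push_cast at this
    simpa using this
  rw [hb']
  exact Submodule.add_mem_sup (Ideal.mul_mem_right _ _ hm) (Ideal.mul_mem_right _ _ hn)

theorem aI_mul (F : Type*) [Field F] [NumberField F] {m n : ℕ} (h : m.Coprime n) :
    aI F (m * n) = aI F m * aI F n := by
  unfold aI
  rw [← Nat.card_prod]
  symm
  have key : ∀ (m n : ℕ), m.Coprime n → ∀ J K : Ideal (𝓞 F), Ideal.absNorm J = m → Ideal.absNorm K = n →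
      J = J * K ⊔ Ideal.span {(m : 𝓞 F)} := by
    intro m n h J K hJ hK
    have hm : (m : 𝓞 F) ∈ J := hJ ▸ Ideal.absNorm_mem J
    have hn : (n : 𝓞 F) ∈ K := hK ▸ Ideal.absNorm_mem K
    have htop : Ideal.span {(m : 𝓞 F)} ⊔ K = ⊤ := sup_coprime_top h (Ideal.mem_span_singleton_self _) hn
    apply le_antisymm
    · calc J = J * (Ideal.span {(m : 𝓞 F)} ⊔ K) := by rw [htop, Ideal.mul_top]
        _ = J * Ideal.span {(m : 𝓞 F)} ⊔ J * K := Ideal.mul_sup _ _ _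
        _ ≤ _ := sup_le (Ideal.mul_le_right.trans le_sup_right) le_sup_left
    · exact sup_le Ideal.mul_le_left ((Ideal.span_singleton_le_iff_mem _).2 hm)
  refine Nat.card_congr (Equiv.ofBijective
    (fun x => ⟨x.1.1 * x.2.1, by rw [map_mul, x.1.2, x.2.2]⟩) ⟨?_, ?_⟩)
  · rintro ⟨⟨J, hJ⟩, ⟨K, hK⟩⟩ ⟨⟨J', hJ'⟩, ⟨K', hK'⟩⟩ he
    simp only [Subtype.mk.injEq] at he
    have e1 : J = J' := by rw [key m n h J K hJ hK, key m n h J' K' hJ' hK', he]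
    have e2 : K = K' := by
      rw [key n m h.symm K J hK hJ, key n m h.symm K' J' hK' hJ', mul_comm K, mul_comm K', he]
    simp [e1, e2]
  · rintro ⟨I, hI⟩
    have hmem : ((m * n : ℕ) : 𝓞 F) ∈ I := hI ▸ Ideal.absNorm_mem I
    set J := I ⊔ Ideal.span {(m : 𝓞 F)} with hJ
    set K := I ⊔ Ideal.span {(n : 𝓞 F)} with hK
    have hprod : J * K = I := by
      apply le_antisymm
      · rw [hJ, hK, Ideal.sup_mul, Ideal.mul_sup, Ideal.mul_sup]
        refine sup_le (sup_le Ideal.mul_le_left Ideal.mul_le_left) (sup_le Ideal.mul_le_right ?_)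
        rw [Ideal.span_singleton_mul_span_singleton, Ideal.span_singleton_le_iff_mem]
        exact_mod_cast hmem
      · have htop : Ideal.span {(m : 𝓞 F)} ⊔ Ideal.span {(n : 𝓞 F)} = ⊤ :=
          sup_coprime_top h (Ideal.mem_span_singleton_self _) (Ideal.mem_span_singleton_self _)
        calc I = (Ideal.span {(m : 𝓞 F)} ⊔ Ideal.span {(n : 𝓞 F)}) * I := by rw [htop, Ideal.top_mul]
          _ = Ideal.span {(m : 𝓞 F)} * I ⊔ I * Ideal.span {(n : 𝓞 F)} := by
              rw [Ideal.sup_mul, mul_comm I]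
          _ ≤ J * K := sup_le (Ideal.mul_mono le_sup_right le_sup_left)
              (Ideal.mul_mono le_sup_left le_sup_right)
    have hNJ : Ideal.absNorm J ∣ m ^ Module.finrank ℚ F := by
      rw [← absNorm_nat]; exact Ideal.absNorm_dvd_absNorm_of_le le_sup_right
    have hNK : Ideal.absNorm K ∣ n ^ Module.finrank ℚ F := by
      rw [← absNorm_nat]; exact Ideal.absNorm_dvd_absNorm_of_le le_sup_right
    have hNJK : Ideal.absNorm J * Ideal.absNorm K = m * n := by rw [← map_mul, hprod, hI]
    have c1 : (Ideal.absNorm J).Coprime n := Nat.Coprime.coprime_dvd_left hNJ (h.pow_left _)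
    have c2 : (Ideal.absNorm K).Coprime m := Nat.Coprime.coprime_dvd_left hNK (h.symm.pow_left _)
    have d1 : Ideal.absNorm J ∣ m := c1.dvd_of_dvd_mul_right (hNJK ▸ dvd_mul_right _ _)
    have d2 : Ideal.absNorm K ∣ n := c2.dvd_of_dvd_mul_left (hNJK ▸ dvd_mul_left _ _)
    have d3 : m ∣ Ideal.absNorm J := by
      apply Nat.Coprime.dvd_of_dvd_mul_right c2.symm
      rw [hNJK]; exact dvd_mul_right _ _
    have d4 : n ∣ Ideal.absNorm K := by
      apply Nat.Coprime.dvd_of_dvd_mul_left c1.symm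
      rw [hNJK]; exact dvd_mul_left _ _
    exact ⟨⟨⟨J, Nat.dvd_antisymm d1 d3⟩, ⟨K, Nat.dvd_antisymm d2 d4⟩⟩, Subtype.ext hprod⟩

theorem aI_one (F : Type*) [Field F] [NumberField F] : aI F 1 = 1 := by
  unfold aI
  rw [Nat.card_eq_one_iff_unique]
  refine ⟨⟨fun a b => Subtype.ext ?_⟩, ⟨⊤, by simp⟩⟩
  rw [Ideal.absNorm_eq_one_iff.1 a.2, Ideal.absNorm_eq_one_iff.1 b.2]

/-- an ideal of norm `ℓ^(k+1)` is divisible by a prime containing ℓ -/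
theorem exists_factor {F : Type*} [Field F] [NumberField F] {l : ℕ} (hl : l.Prime) {k : ℕ}
    {I : Ideal (𝓞 F)} (hI : Ideal.absNorm I = l ^ (k + 1)) :
    ∃ P J : Ideal (𝓞 F), P.IsPrime ∧ (l : 𝓞 F) ∈ P ∧ I = P * J := by
  have hne : I ≠ ⊤ := by
    intro h
    rw [h, Ideal.absNorm_top] at hI
    exact absurd hI.symm (Nat.one_lt_pow (by omega) hl.one_lt).ne'
  obtain ⟨P, hP, hIP⟩ := Ideal.exists_le_maximal I hne
  have hmem : ((l ^ (k+1) : ℕ) : 𝓞 F) ∈ P := hIP (hI ▸ Ideal.absNorm_mem I)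
  push_cast at hmem
  obtain ⟨J, hJ⟩ := Ideal.dvd_iff_le.2 hIP
  exact ⟨P, J, hP.isPrime, hP.isPrime.mem_of_pow_mem _ hmem, hJ⟩

theorem aI_inert {F : Type*} [Field F] [NumberField F] (h2 : Module.finrank ℚ F = 2)
    {l : ℕ} (hl : l.Prime)
    (hP : ∀ P : Ideal (𝓞 F), P.IsPrime → (l : 𝓞 F) ∈ P → P = Ideal.span {(l : 𝓞 F)}) (k : ℕ) :
    aI F (l ^ k) = if Even k then 1 else 0 := by
  have hN : Ideal.absNorm (Ideal.span {(l : 𝓞 F)}) = l ^ 2 := by rw [absNorm_nat, h2]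
  have hl0 : Ideal.span {(l : 𝓞 F)} ≠ ⊥ := by
    intro h; rw [h, Ideal.absNorm_bot] at hN
    exact (pow_ne_zero 2 hl.ne_zero) hN.symm
  induction k using Nat.strong_induction_on with
  | _ k ih =>
    match k with
    | 0 => simp [aI_one]
    | 1 =>
      simp only [Nat.not_even_one, if_false]
      unfold aI
      rw [Nat.card_eq_zero]
      left
      refine ⟨fun ⟨I, hI⟩ => ?_⟩
      obtain ⟨P, J, hPp, hlP, hIJ⟩ := exists_factor hl (k := 0) (by simpa using hI)
      rw [hP P hPp hlP] at hIJ
      rw [hIJ, map_mul, hN, pow_one] at hI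
      have : l ^ 2 ∣ l ^ 1 := ⟨_, by rw [hI, pow_one]⟩
      have := (Nat.pow_dvd_pow_iff_le_right hl.one_lt).1 this
      omega
    | k + 2 =>
      have := ih k (by omega)
      have e : (Even (k+2)) ↔ Even k := by simp [Nat.even_add]
      simp only [e]
      rw [← this]
      unfold aI
      symm
      refine Nat.card_congr (Equiv.ofBijective
        (fun x => ⟨Ideal.span {(l : 𝓞 F)} * x.1, by rw [map_mul, hN, x.2]; ring⟩) ⟨?_, ?_⟩)
      · rintro ⟨J, hJ⟩ ⟨J', hJ'⟩ he
        simp only [Subtype.mk.injEq] at he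
        exact Subtype.ext (mul_left_cancel₀ hl0 he)
      · rintro ⟨I, hI⟩
        obtain ⟨P, J, hPp, hlP, hIJ⟩ := exists_factor hl hI
        rw [hP P hPp hlP] at hIJ
        refine ⟨⟨J, ?_⟩, Subtype.ext hIJ.symm⟩
        rw [hIJ, map_mul, hN, show l ^ (k+2) = l^2 * l^k by ring] at hI
        exact Nat.eq_of_mul_eq_mul_left (pow_pos hl.pos 2) hI

theorem aI_ram {F : Type*} [Field F] [NumberField F]
    {l : ℕ} (hl : l.Prime) (Q : Ideal (𝓞 F)) (hQ : Ideal.absNorm Q = l)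
    (hP : ∀ P : Ideal (𝓞 F), P.IsPrime → (l : 𝓞 F) ∈ P → P = Q) (k : ℕ) :
    aI F (l ^ k) = 1 := by
  have : ∀ k, ∀ I : Ideal (𝓞 F), Ideal.absNorm I = l ^ k → I = Q ^ k := by
    intro k
    induction k with
    | zero => intro I hI; simpa [Ideal.absNorm_eq_one_iff] using hI
    | succ k ih =>
      intro I hI
      obtain ⟨P, J, hPp, hlP, hIJ⟩ := exists_factor hl hI
      rw [hP P hPp hlP] at hIJ
      rw [hIJ, map_mul, hQ, pow_succ', ] at hI
      rw [hIJ, ih J (Nat.eq_of_mul_eq_mul_left hl.pos hI), pow_succ']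
  unfold aI
  rw [Nat.card_eq_one_iff_unique]
  exact ⟨⟨fun a b => Subtype.ext ((this k _ a.2).trans (this k _ b.2).symm)⟩,
    ⟨Q ^ k, by rw [map_pow, hQ]⟩⟩

theorem aI_split {F : Type*} [Field F] [NumberField F]
    {l : ℕ} (hl : l.Prime) (Q R : Ideal (𝓞 F)) (hQ : Ideal.absNorm Q = l)
    (hR : Ideal.absNorm R = l) (hQR : Q ≠ R)
    (hP : ∀ P : Ideal (𝓞 F), P.IsPrime → (l : 𝓞 F) ∈ P → P = Q ∨ P = R) (k : ℕ) :
    aI F (l ^ k) = k + 1 := by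
  have hex : ∀ k, ∀ I : Ideal (𝓞 F), Ideal.absNorm I = l ^ k → ∃ i j, i + j = k ∧ I = Q ^ i * R ^ j := by
    intro k
    induction k with
    | zero => intro I hI; exact ⟨0, 0, rfl, by simpa [Ideal.absNorm_eq_one_iff] using hI⟩
    | succ k ih =>
      intro I hI
      obtain ⟨P, J, hPp, hlP, hIJ⟩ := exists_factor hl hI
      rcases hP P hPp hlP with h | h <;> subst h
      · rw [hIJ, map_mul, hQ, pow_succ', ] at hI
        obtain ⟨i, j, hij, hJ⟩ := ih J (Nat.eq_of_mul_eq_mul_left hl.pos hI)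
        exact ⟨i + 1, j, by omega, by rw [hIJ, hJ]; ring⟩
      · rw [hIJ, map_mul, hR, pow_succ', ] at hI
        obtain ⟨i, j, hij, hJ⟩ := ih J (Nat.eq_of_mul_eq_mul_left hl.pos hI)
        exact ⟨i, j + 1, by omega, by rw [hIJ, hJ]; ring⟩
  have hQ0 : Q ≠ ⊥ := by rintro rfl; rw [Ideal.absNorm_bot] at hQ; exact hl.ne_zero hQ.symm
  have hR0 : R ≠ ⊥ := by rintro rfl; rw [Ideal.absNorm_bot] at hR; exact hl.ne_zero hR.symm
  have hQp : Q.IsPrime := Ideal.isPrime_of_irreducible_absNorm (hQ ▸ hl)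
  have hRp : R.IsPrime := Ideal.isPrime_of_irreducible_absNorm (hR ▸ hl)
  have hQm : Q.IsMaximal := hQp.isMaximal hQ0
  have inj : ∀ i j d, i + (j + d) = k → Q ^ (i + d) * R ^ j = Q ^ i * R ^ (j + d) → d = 0 := by
    intro i j d _ he
    have h1 : Q ^ d = R ^ d := by
      have h0 : Q ^ i * R ^ j ≠ 0 := mul_ne_zero (pow_ne_zero _ hQ0) (pow_ne_zero _ hR0)
      apply mul_left_cancel₀ h0
      calc _ = Q ^ (i + d) * R ^ j := by ring
        _ = _ := by rw [he]; ring
    by_contra hd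
    apply hQR
    apply hQm.eq_of_le hRp.ne_top
    apply (Ideal.IsPrime.le_of_pow_le (n := d))
    rw [h1]; exact Ideal.pow_le_self hd
  unfold aI
  rw [← Nat.card_fin (k + 1)]
  symm
  refine Nat.card_congr (Equiv.ofBijective
    (fun x : Fin (k + 1) => ⟨Q ^ (x : ℕ) * R ^ (k - x : ℕ), by
      rw [map_mul, map_pow, map_pow, hQ, hR, ← pow_add]; congr 1; omega⟩) ⟨?_, ?_⟩)
  · rintro ⟨x, hx⟩ ⟨y, hy⟩ he
    simp only [Subtype.mk.injEq] at he
    ext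
    simp only
    rcases le_total x y with h | h
    · obtain ⟨d, rfl⟩ := Nat.exists_eq_add_of_le h
      have := inj x (k - (x + d)) d (by omega) (by
        rw [show k - (x + d) + d = k - x by omega]; exact he.symm)
      omega
    · obtain ⟨d, rfl⟩ := Nat.exists_eq_add_of_le h
      have := inj y (k - (y + d)) d (by omega) (by
        rw [show k - (y + d) + d = k - y by omega]; exact he)
      omega
  · rintro ⟨I, hI⟩
    obtain ⟨i, j, hij, h⟩ := hex k I hI
    refine ⟨⟨i, by omega⟩, Subtype.ext ?_⟩
    simp only
    rw [h, show k - i = j by omega]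

theorem qc_eq (p : ℕ) [Fact p.Prime] (hp3 : p % 4 = 3) {l : ℕ} [Fact l.Prime] (hl2 : l ≠ 2)
    (hlp : l ≠ p) : quadraticChar (ZMod p) (l : ZMod p) = quadraticChar (ZMod l) (-(p : ZMod l)) := by
  have h2 : ringChar (ZMod p) ≠ 2 := by
    rw [ZMod.ringChar_zmod_n]; omega
  rw [quadraticChar_odd_prime h2 hl2 (by rw [ZMod.ringChar_zmod_n]; exact hlp.symm),
    ZMod.card, ZMod.χ₄_nat_three_mod_four hp3]
  simp

theorem qc_two (p : ℕ) [Fact p.Prime] (hp3 : p % 4 = 3) :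
    quadraticChar (ZMod p) (2 : ZMod p) = if p % 8 = 7 then 1 else -1 := by
  have h2 : ringChar (ZMod p) ≠ 2 := by
    rw [ZMod.ringChar_zmod_n]; omega
  rw [quadraticChar_two h2, ZMod.card, ZMod.χ₈_nat_eq_if_mod_eight]
  have : p % 2 = 1 := by omega
  have h8 : p % 8 = 3 ∨ p % 8 = 7 := by omega
  rcases h8 with h | h <;> simp [h, this]

theorem root_iff (p : ℕ) [Fact p.Prime] (hp3 : p % 4 = 3) (c : ℕ) (hc : p + 1 = 4 * c)
    {l : ℕ} [Fact l.Prime] (hlp : l ≠ p) :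
    (∃ r : ℤ, (l : ℤ) ∣ r ^ 2 - r + c) ↔ quadraticChar (ZMod p) (l : ZMod p) = 1 := by
  by_cases hl2 : l = 2
  · subst hl2
    have e := qc_two p hp3
    rw [show ((2 : ℕ) : ZMod p) = 2 by norm_num, e]
    constructor
    · rintro ⟨r, hr⟩
      have : Even (r ^ 2 - r) := by
        rw [show r ^ 2 - r = (r - 1) * (r - 1 + 1) by ring]; exact Int.even_mul_succ_self _
      obtain ⟨m, hm⟩ := this
      rw [if_pos]; omega
    · intro h
      have : p % 8 = 7 := by
        by_contra h'; rw [if_neg h'] at h; norm_num at h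
      exact ⟨0, by simp; omega⟩
  · rw [qc_eq p hp3 hl2 hlp]
    have hl := (Fact.out : l.Prime)
    have hp := (Fact.out : p.Prime)
    have hpl : (-(p : ZMod l)) ≠ 0 := by
      rw [neg_ne_zero, Ne, ZMod.natCast_eq_zero_iff]
      intro h
      exact hlp ((Nat.prime_dvd_prime_iff_eq hl hp).1 h)
    have h2 : (2 : ZMod l) ≠ 0 := by
      have : ((2 : ℕ) : ZMod l) ≠ 0 := by
        rw [Ne, ZMod.natCast_eq_zero_iff]
        intro h
        exact hl2 ((Nat.prime_dvd_prime_iff_eq hl Nat.prime_two).1 h)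
      simpa using this
    have hcZ : (p : ZMod l) + 1 = 4 * c := by exact_mod_cast congrArg (Nat.cast : ℕ → ZMod l) hc
    rw [quadraticChar_one_iff_isSquare hpl]
    constructor
    · rintro ⟨r, hr⟩
      have : ((r ^ 2 - r + c : ℤ) : ZMod l) = 0 := (ZMod.intCast_zmod_eq_zero_iff_dvd _ _).2 hr
      push_cast at this
      exact ⟨2 * r - 1, by linear_combination (-4) * this - hcZ⟩
    · rintro ⟨x, hx⟩
      refine ⟨(((x + 1) / 2 : ZMod l).val : ℤ), ?_⟩
      rw [← ZMod.intCast_zmod_eq_zero_iff_dvd]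
      push_cast
      rw [ZMod.natCast_zmod_val]
      field_simp
      linear_combination (-1) * hx - hcZ

section
variable {F : Type*} [Field F] [NumberField F]

theorem theta_not_rat {p : ℕ} (hp : p.Prime) {θ : F} (hθ : θ ^ 2 = -(p : F)) (q : ℚ) :
    (q : F) ≠ θ := by
  intro h
  rw [← h] at hθ
  have : q ^ 2 = -(p : ℚ) := by exact_mod_cast hθ
  have hp0 : (0 : ℚ) < p := by exact_mod_cast hp.pos
  nlinarith [sq_nonneg q]

theorem minpoly_theta {p : ℕ} (hp : p.Prime) {θ : F} (hθ : θ ^ 2 = -(p : F)) :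
    minpoly ℚ θ = Polynomial.X ^ 2 + Polynomial.C (p : ℚ) := by
  have hm : (Polynomial.X ^ 2 + Polynomial.C (p : ℚ)).Monic := by monicity!
  have hd : (Polynomial.X ^ 2 + Polynomial.C (p : ℚ)).natDegree = 2 := by compute_degree!
  symm
  apply minpoly.eq_of_irreducible_of_monic _ _ hm
  · rw [hm.irreducible_iff_roots_eq_zero_of_degree_le_three (by omega) (by omega)]
    rw [Multiset.eq_zero_iff_forall_notMem]
    intro q hq
    have := Polynomial.isRoot_of_mem_roots hq
    simp at this
    have hp0 : (0 : ℚ) < p := by exact_mod_cast hp.pos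
    nlinarith [sq_nonneg q]
  · simp [hθ]

theorem trace_theta {p : ℕ} (hp : p.Prime) {θ : F} (hθ : θ ^ 2 = -(p : F)) :
    Algebra.trace ℚ F θ = 0 := by
  rw [trace_eq_finrank_mul_minpoly_nextCoeff, minpoly_theta hp hθ]
  have hd : (Polynomial.X ^ 2 + Polynomial.C (p : ℚ)).natDegree = 2 := by compute_degree!
  rw [Polynomial.nextCoeff, hd]
  simp [Polynomial.coeff_X_pow, Polynomial.coeff_C]

theorem exists_omega {p : ℕ} {θ : F} (hθ : θ ^ 2 = -(p : F)) {c : ℕ}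
    (hc : p + 1 = 4 * c) : ∃ ω : 𝓞 F, ω ^ 2 - ω + c = 0 ∧ ((2 * ω - 1 : 𝓞 F) : F) = θ := by
  have hcF : (p : F) + 1 = 4 * c := by exact_mod_cast congrArg (Nat.cast : ℕ → F) hc
  have hroot : ((1 + θ) / 2) ^ 2 - (1 + θ) / 2 + c = 0 := by
    field_simp
    linear_combination hθ - hcF
  have hint : IsIntegral ℤ ((1 + θ) / 2) := by
    refine ⟨Polynomial.X ^ 2 - Polynomial.X + Polynomial.C (c : ℤ), by monicity!, ?_⟩
    simpa using hroot
  obtain ⟨ω, hω⟩ : ∃ ω : 𝓞 F, (ω : F) = (1 + θ) / 2 := ⟨⟨_, hint⟩, rfl⟩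
  refine ⟨ω, ?_, ?_⟩
  · apply RingOfIntegers.ext
    rw [← hω] at hroot
    simpa using hroot
  · simp only [map_sub, map_mul, map_one, map_ofNat, hω]
    field_simp
    ring

theorem om_sq {p c : ℕ} (hc : p + 1 = 4 * c) {ω : 𝓞 F} (hω : ω ^ 2 - ω + c = 0) :
    (2 * ω - 1) ^ 2 = -(p : 𝓞 F) := by
  have hcF : (p : 𝓞 F) + 1 = 4 * c := by exact_mod_cast congrArg (Nat.cast : ℕ → 𝓞 F) hc
  linear_combination 4 * hω + hcF

theorem norm_theta (h2 : Module.finrank ℚ F = 2) {p c : ℕ} (hc : p + 1 = 4 * c) {ω : 𝓞 F}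
    (hω : ω ^ 2 - ω + c = 0) :
    Ideal.absNorm (Ideal.span {2 * ω - 1}) = p := by
  have h : Ideal.span {2 * ω - 1} ^ 2 = Ideal.span {(p : 𝓞 F)} := by
    rw [Ideal.span_singleton_pow, om_sq hc hω, Ideal.span_singleton_neg]
  have := congrArg Ideal.absNorm h
  rw [map_pow, absNorm_nat, h2] at this
  exact Nat.pow_left_injective (by norm_num : 2 ≠ 0) this

theorem not_dvd_om (h2 : Module.finrank ℚ F = 2) {p : ℕ} (hp : p.Prime) {c : ℕ} (hc : p + 1 = 4 * c)
    {ω : 𝓞 F} (hω : ω ^ 2 - ω + c = 0) {l : ℕ} (hl : l.Prime) (s : ℤ) (z : 𝓞 F)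
    (h : ω - s = l * z) : False := by
  have hθ : ((2 * ω - 1 : 𝓞 F) : F) ^ 2 = -(p : F) := by
    rw [← map_pow, om_sq hc hω]; simp
  have ht0 := trace_theta hp hθ
  have ht : Algebra.trace ℤ (𝓞 F) (2 * ω - 1) = 0 := by
    have := Algebra.coe_trace_int (K := F) (2 * ω - 1)
    rw [ht0] at this
    exact_mod_cast this
  have e : 2 * ω - 1 = algebraMap ℤ (𝓞 F) (2 * s - 1) + (2 * l : ℤ) • z := by
    simp only [zsmul_eq_mul]
    push_cast
    simp only [map_ofNat, eq_intCast, map_sub, map_mul, map_one]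
    linear_combination 2 * h
  have ht' := ht
  rw [e, map_add, Algebra.trace_algebraMap, map_zsmul, RingOfIntegers.rank, h2] at ht'
  set t := Algebra.trace ℤ (𝓞 F) z
  have hs : 2 * s - 1 = -(l * t) := by
    simp only [smul_eq_mul, nsmul_eq_mul] at ht'
    push_cast at ht'
    linarith
  have e2 : 2 * ω - 1 = l * (2 * z - t) := by
    have : ((2 * s - 1 : ℤ) : 𝓞 F) = ((-(l * t) : ℤ) : 𝓞 F) := by rw [hs]
    push_cast at this
    linear_combination 2 * h + this
  have hN := norm_theta h2 hc hω
  rw [e2, ← Ideal.span_singleton_mul_span_singleton, map_mul, absNorm_nat, h2] at hN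
  have hd : l ^ 2 ∣ p := ⟨_, hN.symm⟩
  have h1 : l = p := (Nat.prime_dvd_prime_iff_eq hl hp).1 ((dvd_pow_self l (by norm_num)).trans hd)
  rw [h1, pow_two] at hd
  have := Nat.le_of_dvd hp.pos hd
  nlinarith [hp.two_le]

theorem norm_cases (h2 : Module.finrank ℚ F = 2) {l : ℕ} (hl : l.Prime) {P : Ideal (𝓞 F)}
    (hlP : (l : 𝓞 F) ∈ P) : P = ⊤ ∨ Ideal.absNorm P = l ∨ P = Ideal.span {(l : 𝓞 F)} := by
  have hle : Ideal.span {(l : 𝓞 F)} ≤ P := (Ideal.span_singleton_le_iff_mem _).2 hlP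
  obtain ⟨J, hJ⟩ := Ideal.dvd_iff_le.2 hle
  have hN := congrArg Ideal.absNorm hJ
  rw [map_mul, absNorm_nat, h2] at hN
  have hd : Ideal.absNorm P ∣ l ^ 2 := ⟨_, hN⟩
  obtain ⟨k, hk, hPk⟩ := (Nat.dvd_prime_pow hl).1 hd
  interval_cases k
  · left; simpa [Ideal.absNorm_eq_one_iff] using hPk
  · right; left; simpa using hPk
  · right; right
    rw [hPk] at hN
    have : Ideal.absNorm J = 1 := by
      have := pow_pos hl.pos 2
      exact Nat.eq_of_mul_eq_mul_left this (by rw [← hN]; ring)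
    rw [Ideal.absNorm_eq_one_iff] at this
    rw [hJ, this, Ideal.mul_top]

theorem exists_prime_of_root (h2 : Module.finrank ℚ F = 2) {p : ℕ} (hp : p.Prime) {c : ℕ}
    (hc : p + 1 = 4 * c) {ω : 𝓞 F} (hω : ω ^ 2 - ω + c = 0) {l : ℕ} (hl : l.Prime) (r : ℤ)
    (hr : (l : ℤ) ∣ r ^ 2 - r + c) :
    ∃ P : Ideal (𝓞 F), Ideal.absNorm P = l ∧ ω - r ∈ P ∧ (l : 𝓞 F) ∈ P := by
  obtain ⟨m, hm⟩ := hr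
  have hm' : (r : 𝓞 F) ^ 2 - r + c = l * m := by
    exact_mod_cast congrArg (Int.cast : ℤ → 𝓞 F) hm
  refine ⟨Ideal.span {(l : 𝓞 F), ω - r}, ?_, Ideal.subset_span (by simp), Ideal.subset_span (by simp)⟩
  rcases norm_cases h2 hl (P := Ideal.span {(l : 𝓞 F), ω - r}) (Ideal.subset_span (by simp)) with h | h | h
  · exfalso
    rw [Ideal.eq_top_iff_one, Ideal.mem_span_pair] at h
    obtain ⟨a, b, hab⟩ := h
    refine not_dvd_om h2 hp hc hω hl (1 - r) (-(a * (1 - ω - r) + b * m)) ?_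
    push_cast
    linear_combination (1 - ω - r) * hab - b * hm' + b * hω
  · exact h
  · exfalso
    have : ω - r ∈ Ideal.span {(l : 𝓞 F)} := h ▸ Ideal.subset_span (by simp)
    obtain ⟨z, hz⟩ := Ideal.mem_span_singleton.1 this
    exact not_dvd_om h2 hp hc hω hl r z hz

theorem root_of_prime {c : ℕ} {ω : 𝓞 F} (hω : ω ^ 2 - ω + c = 0) {l : ℕ} (hl : l.Prime)
    {P : Ideal (𝓞 F)} (hP : Ideal.absNorm P = l) : ∃ r : ℤ, (l : ℤ) ∣ r ^ 2 - r + c := by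
  have hcard : Nat.card (𝓞 F ⧸ P) = l := by
    rw [← hP, Ideal.absNorm_apply, Submodule.cardQuot_apply]
  have : Finite (𝓞 F ⧸ P) := Nat.finite_of_card_ne_zero (by rw [hcard]; exact hl.ne_zero)
  have := Fintype.ofFinite (𝓞 F ⧸ P)
  have : Fact l.Prime := ⟨hl⟩
  rw [Nat.card_eq_fintype_card] at hcard
  let e := ZMod.ringEquivOfPrime (𝓞 F ⧸ P) hl hcard
  have h1 : (Ideal.Quotient.mk P ω) ^ 2 - Ideal.Quotient.mk P ω + c = 0 := by
    have := congrArg (Ideal.Quotient.mk P) hω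
    simpa using this
  have h3 := congrArg e.symm h1
  simp only [map_add, map_sub, map_pow, map_zero, map_natCast] at h3
  refine ⟨((e.symm (Ideal.Quotient.mk P ω)).val : ℤ), ?_⟩
  rw [← ZMod.intCast_zmod_eq_zero_iff_dvd]
  push_cast
  rw [ZMod.natCast_zmod_val]
  exact h3

theorem aI_prime_pow (h2 : Module.finrank ℚ F = 2) {p : ℕ} [Fact p.Prime] (hp3 : p % 4 = 3) {θ : F}
    (hθ : θ ^ 2 = -(p : F)) {l : ℕ} (hl : l.Prime) (k : ℕ) :
    (aI F (l ^ k) : ℤ) = ∑ j ∈ Finset.range (k + 1), (quadraticChar (ZMod p) (l : ZMod p)) ^ j := by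
  have hp : p.Prime := Fact.out
  have : Fact l.Prime := ⟨hl⟩
  obtain ⟨c, hc⟩ : ∃ c, p + 1 = 4 * c := ⟨(p + 1) / 4, by omega⟩
  obtain ⟨ω, hω, -⟩ := exists_omega hθ hc
  by_cases hlp : l = p
  · subst hlp
    have hN := norm_theta h2 hc hω
    rw [aI_ram hl (Ideal.span {2 * ω - 1}) hN]
    · simp
    · intro P hP hlP
      have hpr : (Ideal.span {2 * ω - 1}).IsPrime := Ideal.isPrime_of_irreducible_absNorm (hN ▸ hl)
      have hne : Ideal.span {2 * ω - 1} ≠ ⊥ := by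
        intro h; rw [h, Ideal.absNorm_bot] at hN; exact hl.ne_zero hN.symm
      have hmax := hpr.isMaximal hne
      symm
      apply hmax.eq_of_le hP.ne_top
      rw [Ideal.span_singleton_le_iff_mem]
      apply hP.mem_of_pow_mem 2
      rw [om_sq hc hω]
      exact neg_mem hlP
  have hri := root_iff p hp3 c hc hlp
  by_cases hroot : ∃ r : ℤ, (l : ℤ) ∣ r ^ 2 - r + c
  · rw [hri.1 hroot]
    obtain ⟨r, hr⟩ := hroot
    have hr' : (l : ℤ) ∣ (1 - r) ^ 2 - (1 - r) + c := by
      rw [show (1 - r) ^ 2 - (1 - r) + (c : ℤ) = r ^ 2 - r + c by ring]; exact hr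
    obtain ⟨Q, hQ, hrQ, hlQ⟩ := exists_prime_of_root h2 hp hc hω hl r hr
    obtain ⟨R, hR, hrR, hlR⟩ := exists_prime_of_root h2 hp hc hω hl (1 - r) hr'
    have hQp : Q.IsPrime := Ideal.isPrime_of_irreducible_absNorm (hQ ▸ hl)
    have hRp : R.IsPrime := Ideal.isPrime_of_irreducible_absNorm (hR ▸ hl)
    have hQ0 : Q ≠ ⊥ := by rintro rfl; rw [Ideal.absNorm_bot] at hQ; exact hl.ne_zero hQ.symm
    have hR0 : R ≠ ⊥ := by rintro rfl; rw [Ideal.absNorm_bot] at hR; exact hl.ne_zero hR.symm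
    have hQm := hQp.isMaximal hQ0
    have hRm := hRp.isMaximal hR0
    have hQR : Q ≠ R := by
      rintro rfl
      have h1 : (2 * r - 1 : 𝓞 F) ∈ Q := by
        have := sub_mem hrR hrQ
        push_cast at this
        convert this using 1; ring
      have h3 : (p : 𝓞 F) ∈ Q := by
        obtain ⟨m, hm⟩ := hr
        have hm' : (r : 𝓞 F) ^ 2 - r + c = l * m := by
          exact_mod_cast congrArg (Int.cast : ℤ → 𝓞 F) hm
        have hcF : (p : 𝓞 F) + 1 = 4 * c := by exact_mod_cast congrArg (Nat.cast : ℕ → 𝓞 F) hc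
        have : (p : 𝓞 F) = l * (4 * m) - (2 * r - 1) * (2 * r - 1) := by
          linear_combination hcF + 4 * hm'
        rw [this]
        exact sub_mem (Ideal.mul_mem_right _ _ hlQ) (Ideal.mul_mem_right _ _ h1)
      have := sup_coprime_top ((Nat.coprime_primes hl hp).2 hlp) hlQ h3
      rw [sup_idem] at this
      exact hQp.ne_top this
    rw [aI_split hl Q R hQ hR hQR]
    · simp
    · intro P hP hlP
      have hcop : IsCoprime Q R := Ideal.isCoprime_iff_sup_eq.2 (Ideal.IsMaximal.coprime_of_ne hQm hRm hQR)
      have hle : Ideal.span {(l : 𝓞 F)} ≤ Q * R := by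
        rw [Ideal.mul_eq_inf_of_isCoprime hcop, Ideal.span_singleton_le_iff_mem]
        exact ⟨hlQ, hlR⟩
      obtain ⟨J, hJ⟩ := Ideal.dvd_iff_le.2 hle
      have hN := congrArg Ideal.absNorm hJ
      rw [map_mul, map_mul, absNorm_nat, h2, hQ, hR] at hN
      have hJ1 : Ideal.absNorm J = 1 :=
        Nat.eq_of_mul_eq_mul_left (mul_pos hl.pos hl.pos) (by rw [← hN]; ring)
      rw [Ideal.absNorm_eq_one_iff] at hJ1
      rw [hJ1, Ideal.mul_top] at hJ
      have : Q * R ≤ P := by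
        rw [← hJ, Ideal.span_singleton_le_iff_mem]; exact hlP
      rcases hP.mul_le.1 this with h | h
      · left; exact (hQm.eq_of_le hP.ne_top h).symm
      · right; exact (hRm.eq_of_le hP.ne_top h).symm
  · have hχ : quadraticChar (ZMod p) (l : ZMod p) = -1 := by
      rw [quadraticChar_eq_neg_one_iff_not_one]
      · exact fun h => hroot (hri.2 h)
      · rw [Ne, ZMod.natCast_eq_zero_iff]
        intro h
        exact hlp ((Nat.prime_dvd_prime_iff_eq hp hl).1 h).symm
    rw [hχ, aI_inert h2 hl, neg_one_geom_sum]
    · simp only [Nat.even_add_one]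
      split_ifs <;> simp_all
    · intro P hP hlP
      rcases norm_cases h2 hl hlP with h | h | h
      · exact absurd h hP.ne_top
      · exact absurd (root_of_prime hω hl h) hroot
      · exact h
end

end partC

section zetafac
open NumberField
variable {F : Type*} [Field F] [NumberField F]

noncomputable def aF (F : Type*) [Field F] [NumberField F] : ArithmeticFunction ℂ :=
  ⟨fun n => if n = 0 then 0 else (aI F n : ℂ), by simp⟩

theorem aF_apply {n : ℕ} (hn : n ≠ 0) : aF F n = (aI F n : ℂ) := by
  change (if n = 0 then 0 else (aI F n : ℂ)) = _
  rw [if_neg hn]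

theorem aF_mult : (aF F).IsMultiplicative := by
  refine ArithmeticFunction.IsMultiplicative.iff_ne_zero.2 ⟨?_, ?_⟩
  · rw [aF_apply one_ne_zero, aI_one]; simp
  · intro m n hm hn hmn
    rw [aF_apply hm, aF_apply hn, aF_apply (mul_ne_zero hm hn), aI_mul F hmn]
    push_cast
    rfl

theorem aF_eq (h2 : Module.finrank ℚ F = 2) {p : ℕ} [Fact p.Prime] (hp3 : p % 4 = 3)
    {θ : F} (hθ : θ ^ 2 = -(p : F)) : aF F = DirichletCharacter.zetaMul (chi p) := by
  rw [ArithmeticFunction.IsMultiplicative.eq_iff_eq_on_prime_powers _ aF_mult _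
    (DirichletCharacter.isMultiplicative_zetaMul _)]
  intro l k hl
  rw [aF_apply (pow_ne_zero _ hl.ne_zero)]
  have h := aI_prime_pow h2 hp3 hθ hl k
  have h' := congrArg (Int.cast : ℤ → ℂ) h
  push_cast at h'
  rw [h', DirichletCharacter.zetaMul, ArithmeticFunction.coe_zeta_mul_apply,
    Nat.sum_divisors_prime_pow hl]
  refine Finset.sum_congr rfl fun i _ => ?_
  rw [← (chi p).apply_eq_toArithmeticFunction_apply (pow_ne_zero _ hl.ne_zero)]
  rw [Nat.cast_pow, map_pow]
  rfl

theorem dedekind_eq (h2 : Module.finrank ℚ F = 2) {p : ℕ} [Fact p.Prime] (hp3 : p % 4 = 3)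
    {θ : F} (hθ : θ ^ 2 = -(p : F)) {s : ℂ} (hs : 1 < s.re) :
    dedekindZeta F s = riemannZeta s * DirichletCharacter.LFunction (chi p) s := by
  have h1 : dedekindZeta F s = LSeries (aF F) s :=
    LSeries_congr (fun {n} hn => (aF_apply hn).symm) s
  rw [h1, aF_eq h2 hp3 hθ, DirichletCharacter.zetaMul, ← ArithmeticFunction.coe_mul,
    LSeries_convolution']
  · rw [(chi p).LFunction_eq_LSeries hs]
    congr 1
    · simp_rw [← ArithmeticFunction.LSeries_zeta_eq_riemannZeta hs, ← ArithmeticFunction.natCoe_apply]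
    · exact (LSeries_congr (chi p).apply_eq_toArithmeticFunction_apply s).symm
  · exact ArithmeticFunction.LSeriesSummable_zeta_iff.mpr hs
  · exact (LSeriesSummable_congr _ fun h ↦ ((chi p).apply_eq_toArithmeticFunction_apply h).symm).mpr <|
      ZMod.LSeriesSummable_of_one_lt_re (chi p) hs

open Filter Topology in
theorem residue_eq (h2 : Module.finrank ℚ F = 2) {p : ℕ} [Fact p.Prime] (hp3 : p % 4 = 3)
    {θ : F} (hθ : θ ^ 2 = -(p : F)) :
    (dedekindZeta_residue F : ℂ) = DirichletCharacter.LFunction (chi p) 1 := by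
  have t1 := tendsto_sub_one_mul_dedekindZeta_nhdsGT F
  have hm : Tendsto (fun s : ℝ => (s : ℂ)) (𝓝[>] 1) (𝓝[≠] 1) := by
    apply tendsto_nhdsWithin_of_tendsto_nhds_of_eventually_within
    · have : Tendsto (fun s : ℝ => (s : ℂ)) (𝓝 1) (𝓝 ((1 : ℝ) : ℂ)) :=
        Complex.continuous_ofReal.tendsto 1
      rw [Complex.ofReal_one] at this
      exact this.mono_left nhdsWithin_le_nhds
    · filter_upwards [self_mem_nhdsWithin] with s hs
      have : (1 : ℝ) < s := hs
      simp only [Set.mem_compl_iff, Set.mem_singleton_iff]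
      exact_mod_cast this.ne'
  have t2 := riemannZeta_residue_one.comp hm
  have hc : Continuous (DirichletCharacter.LFunction (chi p)) :=
    (DirichletCharacter.differentiable_LFunction (chi_ne_one p hp3)).continuous
  have t3 := ((hc.tendsto 1).mono_left (nhdsWithin_le_nhds (s := {1}ᶜ))).comp hm
  have t4 := t2.mul t3
  rw [one_mul] at t4
  refine tendsto_nhds_unique (t1.congr' ?_) t4
  filter_upwards [self_mem_nhdsWithin] with s hs
  have : 1 < (s : ℂ).re := hs
  rw [dedekind_eq h2 hp3 hθ this]
  simp only [Function.comp]
  ring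
end zetafac

section resid
open NumberField
variable {F : Type*} [Field F] [NumberField F]

theorem discr_k (h2 : Module.finrank ℚ F = 2) {p : ℕ} (hp : p.Prime) (hp3 : p % 4 = 3)
    {θ : F} (hθ : θ ^ 2 = -(p : F)) : ∃ k : ℤ, k ^ 2 * discr F = -4 * p := by
  obtain ⟨c, hc⟩ : ∃ c, p + 1 = 4 * c := ⟨(p + 1) / 4, by omega⟩
  obtain ⟨ω, hω, hωθ⟩ := exists_omega hθ hc
  have hsq := om_sq hc hω
  have ht : Algebra.trace ℤ (𝓞 F) (2 * ω - 1) = 0 := by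
    have := Algebra.coe_trace_int (K := F) (2 * ω - 1)
    rw [hωθ, trace_theta hp hθ] at this
    exact_mod_cast this
  generalize 2 * ω - 1 = t at hsq ht
  have hfr : Module.finrank ℤ (𝓞 F) = 2 := by rw [RingOfIntegers.rank, h2]
  let b : Module.Basis (Fin 2) ℤ (𝓞 F) := Module.finBasisOfFinrankEq ℤ (𝓞 F) hfr
  refine ⟨(b.toMatrix ![1, t]).det, ?_⟩
  rw [← discr_eq_discr F b, ← Algebra.discr_of_matrix_vecMul, Module.Basis.toMatrix_map_vecMul]
  have h1 : Algebra.trace ℤ (𝓞 F) 1 = 2 := by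
    have := Algebra.trace_algebraMap (R := ℤ) (S := 𝓞 F) 1
    rw [map_one, hfr] at this
    simpa using this
  have hpp : Algebra.trace ℤ (𝓞 F) (t * t) = - 2 * p := by
    have := Algebra.trace_algebraMap (R := ℤ) (S := 𝓞 F) (-p)
    rw [hfr] at this
    rw [← pow_two, hsq]
    simpa [mul_comm] using this
  rw [Algebra.discr_def, Matrix.det_fin_two]
  simp only [Algebra.traceMatrix_apply, Algebra.traceForm_apply, Matrix.cons_val_zero,
    Matrix.cons_val_one, mul_one, one_mul, h1, ht, hpp]
  ring

theorem tot_complex {p : ℕ} (hp : p.Prime)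
    {θ : F} (hθ : θ ^ 2 = -(p : F)) : IsTotallyComplex F := by
  refine ⟨fun w => ?_⟩
  rw [← InfinitePlace.not_isReal_iff_isComplex]
  intro hw
  let φ := InfinitePlace.embedding_of_isReal hw
  have := congrArg φ hθ
  rw [map_pow, map_neg, map_natCast] at this
  have h1 : (0 : ℝ) < p := by exact_mod_cast hp.pos
  nlinarith [sq_nonneg (φ θ)]

theorem reg_one (h2 : Module.finrank ℚ F = 2) {p : ℕ} (hp : p.Prime)
    {θ : F} (hθ : θ ^ 2 = -(p : F)) : InfinitePlace.nrRealPlaces F = 0 ∧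
    InfinitePlace.nrComplexPlaces F = 1 ∧ Units.regulator F = 1 := by
  have := tot_complex hp hθ
  have h0 : InfinitePlace.nrRealPlaces F = 0 := IsTotallyComplex.nrRealPlaces_eq_zero F
  have h1 : InfinitePlace.nrComplexPlaces F = 1 := by
    have := IsTotallyComplex.finrank F
    omega
  refine ⟨h0, h1, ?_⟩
  have hcard : Fintype.card (InfinitePlace F) = 1 := by
    rw [InfinitePlace.card_eq_nrRealPlaces_add_nrComplexPlaces, h0, h1]
  classical
  have : IsEmpty {w : InfinitePlace F // w ≠ Units.dirichletUnitTheorem.w₀} := by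
    rw [isEmpty_subtype]
    intro w
    rw [not_not]
    exact Fintype.card_le_one_iff.1 hcard.le _ _
  rw [Units.regulator_eq_det', Matrix.det_isEmpty, abs_one]

theorem rat_basis (h2 : Module.finrank ℚ F = 2) {p : ℕ} (hp : p.Prime)
    {θ : F} (hθ : θ ^ 2 = -(p : F)) (x : F) : ∃ a b : ℚ, x = a + b * θ := by
  have hli : LinearIndependent ℚ ![(1 : F), θ] := by
    rw [LinearIndependent.pair_iff' one_ne_zero]
    intro a ha
    apply theta_not_rat hp hθ a
    rw [← ha, Rat.smul_one_eq_cast]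
  have hs := hli.span_eq_top_of_card_eq_finrank (by simp [h2])
  have hx : x ∈ Submodule.span ℚ (Set.range ![(1 : F), θ]) := hs ▸ Submodule.mem_top
  rw [Matrix.range_cons_cons_empty, Submodule.mem_span_pair] at hx
  obtain ⟨a, b, hab⟩ := hx
  refine ⟨a, b, ?_⟩
  rw [← hab, Rat.smul_def, Rat.smul_def, mul_one]

theorem not_sqrt_three (h2 : Module.finrank ℚ F = 2) {p : ℕ} (hp : p.Prime) (hp3 : p ≠ 3)
    {θ : F} (hθ : θ ^ 2 = -(p : F)) (x : F) (hx : x ^ 2 = -3) : False := by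
  obtain ⟨a, b, rfl⟩ := rat_basis h2 hp hθ x
  have e : ((a ^ 2 - b ^ 2 * p + 3 : ℚ) : F) + ((2 * a * b : ℚ) : F) * θ = 0 := by
    push_cast
    linear_combination hx - b ^ 2 * hθ
  have hab : a * b = 0 := by
    by_contra hab
    apply theta_not_rat hp hθ (-(a ^ 2 - b ^ 2 * p + 3) / (2 * a * b))
    have h0 : ((2 * a * b : ℚ) : F) ≠ 0 := by
      rw [Rat.cast_ne_zero, mul_assoc]; exact mul_ne_zero two_ne_zero hab
    rw [Rat.cast_div, div_eq_iff h0, Rat.cast_neg]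
    linear_combination -e
  have e2 : a ^ 2 - b ^ 2 * p + 3 = 0 := by
    have h3 : 2 * a * b = 0 := by rw [mul_assoc, hab, mul_zero]
    rw [h3, Rat.cast_zero, zero_mul, add_zero] at e
    exact_mod_cast e
  rcases mul_eq_zero.1 hab with rfl | rfl
  · have e3 : b ^ 2 * p = 3 := by linarith
    have e4 : (b * p) ^ 2 = ((3 * p : ℕ) : ℚ) := by push_cast; linear_combination p * e3
    have hsq : IsSquare ((3 * p : ℕ) : ℚ) := ⟨b * p, by rw [← e4, pow_two]⟩
    rw [Rat.isSquare_natCast_iff] at hsq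
    obtain ⟨m, hm⟩ := hsq
    have h3m : 3 ∣ m := by
      have : 3 ∣ m * m := ⟨p, hm.symm⟩
      exact (or_self _).mp (Nat.prime_three.dvd_mul.1 this)
    obtain ⟨n, rfl⟩ := h3m
    have : 3 ∣ p := ⟨n * n, by linarith⟩
    exact hp3 ((Nat.prime_dvd_prime_iff_eq Nat.prime_three hp).1 this).symm
  · nlinarith [sq_nonneg a]

theorem torsion_no_odd (h2 : Module.finrank ℚ F = 2) {p : ℕ} (hp : p.Prime) (hp3 : p ≠ 3)
    {θ : F} (hθ : θ ^ 2 = -(p : F)) {q : ℕ} (hq : q.Prime) (hq2 : q ≠ 2) :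
    ¬ q ∣ Units.torsionOrder F := by
  intro hd
  have : Fact q.Prime := ⟨hq⟩
  rw [Units.torsionOrder] at hd
  obtain ⟨u, hu⟩ := exists_prime_orderOf_dvd_card' q hd
  have hz : IsPrimitiveRoot (((u : (𝓞 F)ˣ) : 𝓞 F) : F) q := by
    have h1 := IsPrimitiveRoot.orderOf u
    rw [hu] at h1
    have h2 := IsPrimitiveRoot.coe_submonoidClass_iff.2 h1
    have h3 := IsPrimitiveRoot.coe_units_iff.2 h2
    exact h3.map_of_injective (f := algebraMap (𝓞 F) F) RingOfIntegers.coe_injective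
  generalize (((u : (𝓞 F)ˣ) : 𝓞 F) : F) = z at hz
  have hdeg : q.totient ≤ 2 := by
    have h1 := minpoly.natDegree_le (A := ℚ) z
    rw [h2, ← Polynomial.cyclotomic_eq_minpoly_rat hz hq.pos, Polynomial.natDegree_cyclotomic] at h1
    exact h1
  rw [Nat.totient_prime hq] at hdeg
  have hq3 : q = 3 := by have := hq.two_le; omega
  subst hq3
  have hs := hz.geom_sum_eq_zero (by norm_num)
  simp only [Finset.sum_range_succ, Finset.sum_range_zero, pow_zero, pow_one, zero_add] at hs
  exact not_sqrt_three h2 hp hp3 hθ (2 * z + 1) (by linear_combination 4 * hs)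

theorem main_formula (h2 : Module.finrank ℚ F = 2) {p : ℕ} [Fact p.Prime] (hp3 : p % 4 = 3)
    {θ : F} (hθ : θ ^ 2 = -(p : F)) : ∃ k : ℤ, k ^ 2 * (classNumber F : ℤ) ^ 2 * p ^ 2 * 4 * 4 = 
      4 * 4 * (Units.torsionOrder F : ℤ) ^ 2 * SS p ^ 2 := by
  have hp : p.Prime := Fact.out
  obtain ⟨k, hk⟩ := discr_k h2 hp hp3 hθ
  refine ⟨k, ?_⟩
  obtain ⟨r0, r1, r2⟩ := reg_one h2 hp hθ
  have hr := residue_eq h2 hp3 hθ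
  have hL := L_one_sq p hp3
  rw [← hr] at hL
  have hL' : (dedekindZeta_residue F) ^ 2 = Real.pi ^ 2 * (SS p : ℝ) ^ 2 / p ^ 3 := by
    exact_mod_cast hL
  rw [dedekindZeta_residue_def, r0, r1, r2, div_pow, mul_pow _ (Real.sqrt _),
    Real.sq_sqrt (abs_nonneg _)] at hL'
  have hw : (Units.torsionOrder F : ℝ) ≠ 0 := by exact_mod_cast Units.torsionOrder_ne_zero F
  have hd : (|(discr F : ℝ)|) ≠ 0 := by
    rw [abs_ne_zero]; exact_mod_cast discr_ne_zero F
  have hp0 : (p : ℝ) ≠ 0 := by exact_mod_cast hp.ne_zero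
  have hkd : (k : ℝ) ^ 2 * |(discr F : ℝ)| = 4 * p := by
    have : (k : ℝ) ^ 2 * (discr F : ℝ) = -4 * p := by exact_mod_cast hk
    have h' := congrArg abs this
    rw [abs_mul, abs_of_nonneg (sq_nonneg (k : ℝ)), abs_mul, abs_neg, Nat.abs_cast] at h'
    simpa using h'
  rw [div_eq_div_iff (by positivity) (by positivity)] at hL'
  have hpi : Real.pi ≠ 0 := Real.pi_ne_zero
  have key : 4 * (classNumber F : ℝ) ^ 2 * p ^ 3 =
      (SS p : ℝ) ^ 2 * (Units.torsionOrder F : ℝ) ^ 2 * |(discr F : ℝ)| := by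
    apply mul_left_cancel₀ (pow_ne_zero 2 hpi)
    linear_combination hL'
  have : (k : ℝ) ^ 2 * (classNumber F : ℝ) ^ 2 * p ^ 2 * 4 * 4 =
      4 * 4 * (Units.torsionOrder F : ℝ) ^ 2 * (SS p : ℝ) ^ 2 := by
    apply mul_left_cancel₀ hp0
    linear_combination 4 * (k : ℝ) ^ 2 * key + 
      4 * (SS p : ℝ) ^ 2 * (Units.torsionOrder F : ℝ) ^ 2 * hkd
  exact_mod_cast this
end resid

section combi

theorem sum_eq_SS (p : ℕ) [Fact p.Prime] (hp2 : p ≠ 2)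
    (v : ℕ) (hv : orderOf (v : ZMod p) = p - 1) (vn : ℤ → ℕ)
    (hvn1 : ∀ n : ℤ, 1 ≤ vn n) (hvn2 : ∀ n : ℤ, vn n ≤ p - 1) (hvn0 : vn 0 = 1)
    (hvnrec : ∀ n : ℤ, (vn (n + 1) : ZMod p) = (v : ZMod p) * (vn n : ZMod p)) :
    ∑ i ∈ Finset.range (p - 1), (-1 : ℤ) ^ i * (vn (-(i : ℤ)) : ℤ) = SS p := by
  have hp : p.Prime := Fact.out
  have hp1 : 0 < p - 1 := by have := hp.two_le; omega
  have hv0 : (v : ZMod p) ≠ 0 := by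
    intro h0
    rw [h0, orderOf_zero] at hv
    have := hp.two_le
    omega
  have hval : ∀ n, ((vn n : ZMod p)).val = vn n := fun n => by
    rw [ZMod.val_natCast, Nat.mod_eq_of_lt]
    have := hvn2 n; have := hp.two_le; omega
  have hpow : ∀ i : ℕ, (v : ZMod p) ^ i * (vn (-(i : ℤ)) : ZMod p) = 1 := by
    intro i
    induction i with
    | zero => simp [hvn0]
    | succ i ih =>
      have := hvnrec (-((i + 1 : ℕ) : ℤ))
      rw [show -((i + 1 : ℕ) : ℤ) + 1 = -(i : ℤ) by push_cast; ring] at this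
      rw [← ih, this, pow_succ, mul_assoc]
  have hch : ringChar (ZMod p) ≠ 2 := by rw [ZMod.ringChar_zmod_n]; exact hp2
  have hqv : quadraticChar (ZMod p) (v : ZMod p) = -1 := by
    rw [quadraticChar_neg_one_iff_not_isSquare]
    rintro ⟨r, hr⟩
    have hr0 : r ≠ 0 := by rintro rfl; simp at hr; exact hv0 hr
    have hpo : p % 2 = 1 := hp.eq_two_or_odd.resolve_left hp2
    have h1 : (v : ZMod p) ^ ((p - 1) / 2) = 1 := by
      rw [hr, ← pow_two, ← pow_mul, show 2 * ((p - 1) / 2) = p - 1 by omega]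
      exact ZMod.pow_card_sub_one_eq_one hr0
    have h2 := orderOf_dvd_of_pow_eq_one h1
    rw [hv] at h2
    have := Nat.le_of_dvd (by omega) h2
    omega
  have hq : ∀ i : ℕ, quadraticChar (ZMod p) (vn (-(i : ℤ)) : ZMod p) = (-1) ^ i := by
    intro i
    have := congrArg (quadraticChar (ZMod p)) (hpow i)
    rw [map_mul, map_pow, hqv, map_one] at this
    calc _ = (-1) ^ i * ((-1) ^ i * quadraticChar (ZMod p) (vn (-(i : ℤ)) : ZMod p)) := by
          rw [← mul_assoc, ← mul_pow]; simp
      _ = _ := by rw [this, mul_one]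
  have hinj : Set.InjOn (fun i : ℕ => (vn (-(i : ℤ)) : ZMod p)) (Finset.range (p - 1)) := by
    intro i hi j hj hij
    have hi' : i < p - 1 := by simpa using hi
    have hj' : j < p - 1 := by simpa using hj
    simp only at hij
    have e : (v : ZMod p) ^ i = (v : ZMod p) ^ j := by
      have h1 := hpow i
      have h2 := hpow j
      rw [← hij] at h2
      have h0 : (vn (-(i : ℤ)) : ZMod p) ≠ 0 := right_ne_zero_of_mul (h1 ▸ one_ne_zero)
      exact mul_right_cancel₀ h0 (h1.trans h2.symm)
    exact pow_injOn_Iio_orderOf (by rw [hv]; exact hi') (by rw [hv]; exact hj') e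
  have himg : (Finset.range (p - 1)).image (fun i : ℕ => (vn (-(i : ℤ)) : ZMod p)) =
      Finset.univ.erase 0 := by
    apply Finset.eq_of_subset_of_card_le
    · intro x hx
      obtain ⟨i, -, rfl⟩ := Finset.mem_image.1 hx
      refine Finset.mem_erase.2 ⟨right_ne_zero_of_mul (hpow i ▸ one_ne_zero), Finset.mem_univ _⟩
    · rw [Finset.card_image_of_injOn hinj, Finset.card_erase_of_mem (Finset.mem_univ _),
        Finset.card_univ, ZMod.card, Finset.card_range]
  unfold SS
  rw [← Finset.sum_erase (a := (0 : ZMod p)) Finset.univ (by simp), ← himg,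
    Finset.sum_image hinj]
  refine Finset.sum_congr rfl fun i _ => ?_
  rw [hval, hq, mul_comm]
end combi

open NumberField Finset

theorem statement14
    (p : ℕ) (hp : p.Prime) (hp2 : p ≠ 2)
    (v : ℕ) (hv1 : 1 ≤ v) (hv2 : v ≤ p - 1)
    (hv : orderOf (v : ZMod p) = p - 1)
    (vn : ℤ → ℕ)
    (hvn1 : ∀ n : ℤ, 1 ≤ vn n) (hvn2 : ∀ n : ℤ, vn n ≤ p - 1)
    (hvn0 : vn 0 = 1)
    (hvnrec : ∀ n : ℤ, (vn (n + 1) : ZMod p) = (v : ZMod p) * (vn n : ZMod p))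
    (hp3 : p % 4 = 3) (hpne3 : p ≠ 3)
    (F : Type*) [Field F] [NumberField F]
    (hF2 : Module.finrank ℚ F = 2)
    (θ : F) (hθ : θ ^ 2 = -(p : F))
    (h : ℕ) (hh : h.Prime) (hhodd : h ≠ 2)
    (hdvd : h ∣ NumberField.classNumber F) :
    (h : ℤ) ∣ ∑ i ∈ Finset.range (p - 1), (-1 : ℤ) ^ i * (vn (-(i : ℤ)) : ℤ) := by
  haveI : Fact p.Prime := ⟨hp⟩
  rw [sum_eq_SS p hp2 v hv vn hvn1 hvn2 hvn0 hvnrec]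
  obtain ⟨k, hk⟩ := main_formula hF2 hp3 hθ
  have hhp : Prime (h : ℤ) := Nat.prime_iff_prime_int.1 hh
  have hc : (h : ℤ) ∣ (classNumber F : ℤ) := by exact_mod_cast hdvd
  have hk' : k ^ 2 * (classNumber F : ℤ) ^ 2 * p ^ 2 =
      (Units.torsionOrder F : ℤ) ^ 2 * SS p ^ 2 := by linarith
  have hd : (h : ℤ) ∣ (Units.torsionOrder F : ℤ) ^ 2 * SS p ^ 2 := by
    rw [← hk']
    exact Dvd.dvd.mul_right (Dvd.dvd.mul_left (dvd_pow hc two_ne_zero) _) _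
  rcases hhp.dvd_or_dvd hd with h1 | h1
  · exact absurd (by exact_mod_cast hhp.dvd_of_dvd_pow h1)
      (torsion_no_odd hF2 hp hpne3 hθ hh hhodd)
  · exact hhp.dvd_of_dvd_pow h1
end

section
/- Suppose p ≡ 3 (mod 4) and p ≠ 3. If h is an odd prime dividing the class number of the imaginary quadratic field ℚ(√−p), then 2·Σ_{i=0}^{(p-3)/2} (−1)^i·v_{-i} − p ≡ 0 (mod h). -/
open NumberField Finset

set_option linter.unusedSectionVars false

section ideals
variable {O : Type*} [CommRing O] [IsDedekindDomain O] [Module.Free ℤ O] [Module.Finite ℤ O]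

lemma aux_sup_top {A B : Ideal O} {m n : ℕ} (hmn : m.Coprime n) (hA : (m : O) ∈ A) (hB : (n : O) ∈ B) :
    A ⊔ B = ⊤ := by
  rw [Ideal.eq_top_iff_one]
  obtain ⟨u, v, huv⟩ := (Nat.isCoprime_iff_coprime.mpr hmn)
  have h1 : (u : O) * m + v * n = 1 := by exact_mod_cast congrArg (Int.cast : ℤ → O) huv
  rw [← h1]
  exact Ideal.add_mem _ (Ideal.mul_mem_left _ _ (Ideal.mem_sup_left hA)) (Ideal.mul_mem_left _ _ (Ideal.mem_sup_right hB))

lemma aux_recover {A B : Ideal O} {m n : ℕ} (hmn : m.Coprime n) (hA : Ideal.absNorm A = m)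
    (hB : Ideal.absNorm B = n) : A * B ⊔ Ideal.span {(m : O)} = A := by
  have hmA : (m : O) ∈ A := hA ▸ Ideal.absNorm_mem A
  have hnB : (n : O) ∈ B := hB ▸ Ideal.absNorm_mem B
  apply le_antisymm
  · refine sup_le Ideal.mul_le_left ?_
    rwa [Ideal.span_singleton_le_iff_mem]
  · calc A = A * (Ideal.span {(m:O)} ⊔ B) := by
          rw [aux_sup_top hmn (Ideal.mem_span_singleton_self _) hnB, Ideal.mul_top]
      _ = A * Ideal.span {(m:O)} ⊔ A * B := Ideal.mul_sup _ _ _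
      _ ≤ _ := sup_le (Ideal.mul_le_right.trans le_sup_right) le_sup_left

lemma aux_prod {I : Ideal O} {m n : ℕ} (hmn : m.Coprime n) (hI : Ideal.absNorm I = m * n) :
    (I ⊔ Ideal.span {(m : O)}) * (I ⊔ Ideal.span {(n : O)}) = I := by
  have hmI : ((m * n : ℕ) : O) ∈ I := hI ▸ Ideal.absNorm_mem I
  apply le_antisymm
  · rw [Ideal.sup_mul, Ideal.mul_sup, Ideal.mul_sup]
    refine sup_le (sup_le Ideal.mul_le_left Ideal.mul_le_left) (sup_le Ideal.mul_le_right ?_)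
    rw [Ideal.span_singleton_mul_span_singleton, Ideal.span_singleton_le_iff_mem]
    exact_mod_cast hmI
  · calc I = I * (Ideal.span {(m:O)} ⊔ Ideal.span {(n:O)}) := by
          rw [aux_sup_top hmn (Ideal.mem_span_singleton_self _) (Ideal.mem_span_singleton_self _), Ideal.mul_top]
      _ = I * Ideal.span {(m:O)} ⊔ I * Ideal.span {(n:O)} := Ideal.mul_sup _ _ _
      _ ≤ _ := by
        refine sup_le ?_ ?_
        · rw [mul_comm]; exact Ideal.mul_mono le_sup_right le_sup_left
        · exact Ideal.mul_mono le_sup_left le_sup_right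

variable (O) in
noncomputable def rcount (n : ℕ) : ℕ := Nat.card {I : Ideal O // Ideal.absNorm I = n}

lemma rcount_mul [CharZero O] {m n : ℕ} (hmn : m.Coprime n) (hm : m ≠ 0) (hn : n ≠ 0) :
    rcount O (m * n) = rcount O m * rcount O n := by
  unfold rcount
  rw [← Nat.card_prod]
  symm
  refine Nat.card_congr (Equiv.ofBijective (fun x => ⟨x.1.1 * x.2.1, by
    rw [map_mul, x.1.2, x.2.2]⟩) ⟨?_, ?_⟩)
  · rintro ⟨⟨A, hA⟩, ⟨B, hB⟩⟩ ⟨⟨A', hA'⟩, ⟨B', hB'⟩⟩ h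
    simp only [Subtype.mk.injEq] at h
    have e1 : A = A' := by rw [← aux_recover hmn hA hB, h, aux_recover hmn hA' hB']
    have e2 : B = B' := by
      rw [← aux_recover hmn.symm hB hA, mul_comm, h, mul_comm, aux_recover hmn.symm hB' hA']
    subst e1 e2; rfl
  · rintro ⟨I, hI⟩
    have hp := aux_prod hmn hI
    have hN := congrArg Ideal.absNorm hp
    rw [map_mul, hI] at hN
    set A := I ⊔ Ideal.span {(m : O)}
    set B := I ⊔ Ideal.span {(n : O)}
    have hA : Ideal.absNorm A ∣ m ^ Module.finrank ℤ O := by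
      rw [← Ideal.absNorm_span_natCast]; exact Ideal.absNorm_dvd_absNorm_of_le le_sup_right
    have hB : Ideal.absNorm B ∣ n ^ Module.finrank ℤ O := by
      rw [← Ideal.absNorm_span_natCast]; exact Ideal.absNorm_dvd_absNorm_of_le le_sup_right
    have hA1 : Ideal.absNorm A ∣ m :=
      Nat.Coprime.dvd_of_dvd_mul_right (Nat.Coprime.coprime_dvd_left hA (hmn.pow_left _)) (hN ▸ dvd_mul_right _ _)
    have hB1 : Ideal.absNorm B ∣ n :=
      Nat.Coprime.dvd_of_dvd_mul_left (Nat.Coprime.coprime_dvd_left hB (hmn.symm.pow_left _)) (hN ▸ dvd_mul_left _ _)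
    have hA2 := Nat.le_of_dvd (Nat.pos_of_ne_zero hm) hA1
    have hB2 := Nat.le_of_dvd (Nat.pos_of_ne_zero hn) hB1
    have hA3 : Ideal.absNorm A = m := by
      by_contra hne
      have : Ideal.absNorm A < m := lt_of_le_of_ne hA2 hne
      have := Nat.mul_lt_mul_of_lt_of_le this hB2 (Nat.pos_of_ne_zero hn)
      omega
    have hB3 : Ideal.absNorm B = n := by
      rw [hA3] at hN; exact Nat.eq_of_mul_eq_mul_left (Nat.pos_of_ne_zero hm) hN
    exact ⟨⟨⟨A, hA3⟩, ⟨B, hB3⟩⟩, by simpa using hp⟩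

lemma rcount_one : rcount O 1 = 1 := by
  unfold rcount
  simp [Ideal.absNorm_eq_one_iff]

lemma dvd_span_pow {I : Ideal O} {q e : ℕ} (h : Ideal.absNorm I = q ^ e) :
    I ∣ (Ideal.span {(q : O)}) ^ e := by
  rw [Ideal.span_singleton_pow, Ideal.dvd_span_singleton]
  exact_mod_cast h ▸ Ideal.absNorm_mem I

/-- ramified -/
lemma rcount_ram {P : Ideal O} {q : ℕ} (hq : q.Prime) (hP : Ideal.absNorm P = q)
    (hPP : Ideal.span {(q : O)} = P ^ 2) (e : ℕ) : rcount O (q ^ e) = 1 := by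
  have hP0 : P ≠ ⊥ := by rintro rfl; simp at hP; exact hq.ne_zero hP.symm
  have hPp : Prime P := Ideal.prime_of_isPrime hP0
    (Ideal.isPrime_of_irreducible_absNorm (hP ▸ hq))
  unfold rcount
  rw [Nat.card_eq_one_iff_unique]
  refine ⟨⟨?_⟩, ⟨⟨P ^ e, by rw [map_pow, hP]⟩⟩⟩
  have key : ∀ I : Ideal O, Ideal.absNorm I = q ^ e → I = P ^ e := by
    intro I hI
    have h1 := dvd_span_pow hI
    rw [hPP, ← pow_mul, dvd_prime_pow hPp] at h1
    obtain ⟨i, -, hi⟩ := h1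
    rw [associated_iff_eq] at hi
    rw [hi, map_pow, hP] at hI
    rw [hi, Nat.pow_right_injective hq.two_le hI]
  rintro ⟨I, hI⟩ ⟨J, hJ⟩
  rw [Subtype.mk.injEq, key I hI, key J hJ]

/-- inert -/
lemma rcount_inert {q : ℕ} (hq : q.Prime) (hP : Ideal.absNorm (Ideal.span {(q : O)}) = q ^ 2)
    (hPp : Prime (Ideal.span {(q : O)})) (e : ℕ) : rcount O (q ^ e) = if Even e then 1 else 0 := by
  have key : ∀ I : Ideal O, Ideal.absNorm I = q ^ e → ∃ i, e = 2 * i ∧ I = (Ideal.span {(q : O)}) ^ i := by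
    intro I hI
    have h1 := dvd_span_pow hI
    rw [dvd_prime_pow hPp] at h1
    obtain ⟨i, -, hi⟩ := h1
    rw [associated_iff_eq] at hi
    rw [hi, map_pow, hP, ← pow_mul] at hI
    exact ⟨i, (Nat.pow_right_injective hq.two_le hI).symm, hi⟩
  unfold rcount
  split_ifs with he
  · obtain ⟨k, hk⟩ := he
    rw [Nat.card_eq_one_iff_unique]
    refine ⟨⟨?_⟩, ⟨⟨(Ideal.span {(q : O)}) ^ k, by rw [map_pow, hP, ← pow_mul]; congr 1; omega⟩⟩⟩
    rintro ⟨I, hI⟩ ⟨J, hJ⟩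
    obtain ⟨i, h1, h2⟩ := key I hI
    obtain ⟨j, h3, h4⟩ := key J hJ
    rw [Subtype.mk.injEq, h2, h4]; congr 1; omega
  · rw [Nat.card_eq_zero]; left
    refine ⟨?_⟩
    rintro ⟨I, hI⟩
    obtain ⟨i, h1, h2⟩ := key I hI
    exact he ⟨i, by omega⟩

/-- split -/
lemma rcount_split {P Q : Ideal O} {q : ℕ} (hq : q.Prime) (hP : Ideal.absNorm P = q)
    (hQ : Ideal.absNorm Q = q) (hne : P ≠ Q)
    (hPP : Ideal.span {(q : O)} = P * Q) (e : ℕ) : rcount O (q ^ e) = e + 1 := by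
  have hP0 : P ≠ ⊥ := by rintro rfl; simp at hP; exact hq.ne_zero hP.symm
  have hPp : Prime P := Ideal.prime_of_isPrime hP0
    (Ideal.isPrime_of_irreducible_absNorm (hP ▸ hq))
  have hQ0 : Q ≠ ⊥ := by rintro rfl; simp at hQ; exact hq.ne_zero hQ.symm
  have hQp : Prime Q := Ideal.prime_of_isPrime hQ0
    (Ideal.isPrime_of_irreducible_absNorm (hQ ▸ hq))
  have hnd : ¬ P ∣ Q := fun h => hne (associated_iff_eq.mp ((hPp.dvd_prime_iff_associated hQp).mp h))
  unfold rcount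
  rw [← Nat.card_fin (e + 1)]
  symm
  refine Nat.card_congr (Equiv.ofBijective (fun i : Fin (e+1) => ⟨P ^ (i : ℕ) * Q ^ (e - i), by
    rw [map_mul, map_pow, map_pow, hP, hQ, ← pow_add]; congr 1; omega⟩) ⟨?_, ?_⟩)
  · have main : ∀ i j : ℕ, i < j → P ^ i * Q ^ (e - i) ≠ P ^ j * Q ^ (e - j) := by
      intro i j hij h
      have : j = i + (j - i - 1) + 1 := by omega
      rw [this, pow_succ, pow_add, mul_assoc, mul_assoc] at h
      have h2 := mul_left_cancel₀ (pow_ne_zero i hPp.ne_zero) h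
      have h3 : P ∣ Q ^ (e - i) := ⟨P ^ (j - i - 1) * Q ^ (e - (i + (j - i - 1) + 1)), by rw [h2]; ring⟩
      exact hnd (hPp.dvd_of_dvd_pow h3)
    rintro ⟨i, hi⟩ ⟨j, hj⟩ h
    simp only [Subtype.mk.injEq] at h
    rw [Fin.mk.injEq]
    rcases lt_trichotomy i j with h1 | h1 | h1
    · exact absurd h (main _ _ h1)
    · exact h1
    · exact absurd h.symm (main _ _ h1)
  · rintro ⟨I, hI⟩
    have h1 := dvd_span_pow hI
    rw [hPP, mul_pow] at h1
    obtain ⟨a, b, ha, hb, rfl⟩ := exists_dvd_and_dvd_of_dvd_mul h1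
    rw [dvd_prime_pow hPp] at ha
    rw [dvd_prime_pow hQp] at hb
    obtain ⟨i, -, hi⟩ := ha
    obtain ⟨j, -, hj⟩ := hb
    rw [associated_iff_eq] at hi hj
    subst hi hj
    rw [map_mul, map_pow, map_pow, hP, hQ, ← pow_add] at hI
    have := Nat.pow_right_injective hq.two_le hI
    exact ⟨⟨i, by omega⟩, by simp only [Subtype.mk.injEq]; congr 2; omega⟩

end ideals

section split
variable {O : Type*} [CommRing O] [IsDedekindDomain O] [Module.Free ℤ O] [Module.Finite ℤ O]

lemma tr_dvd (tr : O →ₗ[ℤ] ℤ) {q : ℕ} {x : O} (h : x ∈ Ideal.span {(q : O)}) : (q : ℤ) ∣ tr x := by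
  rw [Ideal.mem_span_singleton] at h
  obtain ⟨c, rfl⟩ := h
  have : (q : O) * c = (q : ℤ) • c := by simp
  rw [this, map_smul]
  exact ⟨tr c, by simp⟩

lemma split_case [CharZero O] (h2 : Module.finrank ℤ O = 2) {ω : O} {m : ℤ} (hω : ω ^ 2 = ω - m)
    (tr : O →ₗ[ℤ] ℤ) (tr1 : tr 1 = 2) (trω : tr ω = 1) {q : ℕ} (hq : q.Prime) (b : ℤ)
    (hb : (q : ℤ) ∣ b ^ 2 - b + m) (hb2 : ¬ (q : ℤ) ∣ 1 - 2 * b) (e : ℕ) :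
    rcount O (q ^ e) = e + 1 := by
  have trint : ∀ n : ℤ, tr (n : O) = n * 2 := by
    intro n
    have : (n : O) = n • (1 : O) := by simp
    rw [this, map_smul, tr1]; simp
  set P := Ideal.span {(q : O), ω - b} with hPdef
  set Q := Ideal.span {(q : O), 1 - ω - b} with hQdef
  obtain ⟨N, hN⟩ := hb
  have hNO : (ω - b) * (1 - ω - b) = (q : O) * N := by
    have : ((b ^ 2 - b + m : ℤ) : O) = ((q * N : ℤ) : O) := by rw [hN]
    push_cast at this
    rw [← this]; linear_combination -hω
  have hcop : IsCoprime (q : ℤ) (1 - 2 * b) :=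
    (Nat.prime_iff_prime_int.mp hq).coprime_iff_not_dvd.mpr hb2
  obtain ⟨u, w, huw⟩ := hcop
  have huwO : (u : O) * q + w * (1 - 2 * b) = 1 := by exact_mod_cast congrArg (Int.cast : ℤ → O) huw
  have hqP : (q : O) ∈ P := Ideal.subset_span (by simp)
  have hqQ : (q : O) ∈ Q := Ideal.subset_span (by simp)
  have hωP : ω - b ∈ P := Ideal.subset_span (by simp)
  have hωQ : 1 - ω - b ∈ Q := Ideal.subset_span (by simp)
  have hPQ : Ideal.span {(q : O)} = P * Q := by
    apply le_antisymm
    · rw [Ideal.span_singleton_le_iff_mem]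
      have : (q : O) = u * (q * q) + w * ((ω - b) * q + q * (1 - ω - b)) := by
        linear_combination (-(q:O)) * huwO
      rw [this]
      exact Ideal.add_mem _ (Ideal.mul_mem_left _ _ (Ideal.mul_mem_mul hqP hqQ))
        (Ideal.mul_mem_left _ _ (Ideal.add_mem _ (Ideal.mul_mem_mul hωP hqQ) (Ideal.mul_mem_mul hqP hωQ)))
    · rw [hPdef, hQdef, Ideal.span_mul_span', Ideal.span_le]
      rintro _ ⟨x, hx, y, hy, rfl⟩
      simp only [Set.mem_insert_iff, Set.mem_singleton_iff] at hx hy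
      simp only [SetLike.mem_coe, Ideal.mem_span_singleton]
      rcases hx with rfl | rfl <;> rcases hy with rfl | rfl
      · exact dvd_mul_right _ _
      · exact dvd_mul_right _ _
      · exact dvd_mul_left _ _
      · exact ⟨_, hNO⟩
  have hNq := congrArg Ideal.absNorm hPQ
  rw [map_mul, Ideal.absNorm_span_natCast, h2] at hNq
  have hP1 : Ideal.absNorm P ≠ 1 := by
    intro h
    rw [Ideal.absNorm_eq_one_iff] at h
    rw [h, Ideal.top_mul] at hPQ
    rw [← hPQ] at hωQ
    have := tr_dvd tr hωQ
    rw [map_sub, map_sub, tr1, trω, trint] at this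
    exact hb2 (by convert this using 1; ring)
  have hQ1 : Ideal.absNorm Q ≠ 1 := by
    intro h
    rw [Ideal.absNorm_eq_one_iff] at h
    rw [h, Ideal.mul_top] at hPQ
    rw [← hPQ] at hωP
    have := tr_dvd tr hωP
    rw [map_sub, trω, trint] at this
    exact hb2 (by convert this using 1; ring)
  have hPn : Ideal.absNorm P = q := by
    obtain ⟨i, hi, hPi⟩ := (Nat.dvd_prime_pow hq).mp (Dvd.intro _ hNq.symm)
    interval_cases i
    · exact absurd (by simpa using hPi) hP1
    · simpa using hPi
    · rw [hPi] at hNq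
      exact absurd (Nat.eq_of_mul_eq_mul_left (pow_pos hq.pos 2) (hNq.symm.trans (mul_one _).symm)) hQ1
  have hQn : Ideal.absNorm Q = q := by
    rw [hPn, sq] at hNq
    exact (Nat.eq_of_mul_eq_mul_left hq.pos hNq).symm
  refine rcount_split hq hPn hQn ?_ hPQ e
  intro h
  apply hP1
  rw [Ideal.absNorm_eq_one_iff, Ideal.eq_top_iff_one, ← huwO]
  have h3 : (1 - 2 * b : O) ∈ P := by
    have : (1 - 2 * b : O) = (ω - b) + (1 - ω - b) := by ring
    rw [this]; exact Ideal.add_mem _ hωP (h ▸ hωQ)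
  exact Ideal.add_mem _ (Ideal.mul_mem_left _ _ hqP) (Ideal.mul_mem_left _ _ h3)

lemma inert_case [CharZero O] (h2 : Module.finrank ℤ O = 2) {ω : O} {m : ℤ} (hω : ω ^ 2 = ω - m)
    {q : ℕ} (hq : q.Prime) (hb : ∀ b : ℤ, ¬ (q : ℤ) ∣ b ^ 2 - b + m) (e : ℕ) :
    rcount O (q ^ e) = if Even e then 1 else 0 := by
  have hN : Ideal.absNorm (Ideal.span {(q : O)}) = q ^ 2 := by rw [Ideal.absNorm_span_natCast, h2]
  refine rcount_inert hq hN ?_ e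
  have hne : Ideal.span {(q : O)} ≠ ⊤ := by
    rw [Ne, ← Ideal.absNorm_eq_one_iff, hN]
    exact (Nat.one_lt_pow two_ne_zero hq.one_lt).ne'
  obtain ⟨P, hPm, hle⟩ := Ideal.exists_le_maximal _ hne
  have hqP : (q : O) ∈ P := hle (Ideal.mem_span_singleton_self _)
  have hP1 : Ideal.absNorm P ≠ 1 := by rw [Ne, Ideal.absNorm_eq_one_iff]; exact hPm.ne_top
  have hPq : Ideal.absNorm P ≠ q := by
    intro h
    have : Fact q.Prime := ⟨hq⟩
    have hc : Nat.card (O ⧸ P) = q := by rw [← h, Ideal.absNorm_apply, Submodule.cardQuot_apply]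
    have : Nontrivial (O ⧸ P) := Ideal.Quotient.nontrivial_iff.mpr hPm.ne_top
    have hz := zmultiples_eq_top_of_prime_card hc (one_ne_zero (α := O ⧸ P))
    have hmem : Ideal.Quotient.mk P ω ∈ AddSubgroup.zmultiples (1 : O ⧸ P) := by rw [hz]; trivial
    obtain ⟨b, hb'⟩ := AddSubgroup.mem_zmultiples_iff.mp hmem
    have hωP : ω - b ∈ P := by
      rw [← Ideal.Quotient.eq_zero_iff_mem, map_sub, ← hb']; simp
    have hcop : IsCoprime (q : ℤ) (b ^ 2 - b + m) :=
      (Nat.prime_iff_prime_int.mp hq).coprime_iff_not_dvd.mpr (hb b)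
    obtain ⟨u, w, huw⟩ := hcop
    have huwO : (u : O) * q + w * (b ^ 2 - b + m) = 1 := by
      exact_mod_cast congrArg (Int.cast : ℤ → O) huw
    apply hPm.ne_top
    rw [Ideal.eq_top_iff_one, ← huwO]
    have : (b ^ 2 - b + m : O) = (1 - ω - b) * (ω - b) := by linear_combination hω
    rw [this]
    exact Ideal.add_mem _ (Ideal.mul_mem_left _ _ hqP) (Ideal.mul_mem_left _ _ (Ideal.mul_mem_left _ _ hωP))
  have hPn : Ideal.absNorm P = q ^ 2 := by
    have hd := Ideal.absNorm_dvd_absNorm_of_le hle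
    rw [hN] at hd
    obtain ⟨i, hi, hPi⟩ := (Nat.dvd_prime_pow hq).mp hd
    interval_cases i
    · simp at hPi; exact absurd hPi (by simpa using hP1)
    · simp at hPi; exact absurd hPi hPq
    · exact hPi
  obtain ⟨J, hJ⟩ := Ideal.dvd_iff_le.mpr hle
  have hJN := congrArg Ideal.absNorm hJ
  rw [map_mul, hN, hPn] at hJN
  have hJ1 : Ideal.absNorm J = 1 :=
    (Nat.eq_of_mul_eq_mul_left (pow_pos hq.pos 2) ((mul_one _).trans hJN)).symm
  rw [Ideal.absNorm_eq_one_iff] at hJ1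
  rw [hJ, hJ1, Ideal.mul_top]
  refine Ideal.prime_of_isPrime ?_ hPm.isPrime
  rintro rfl
  simp at hPn
  exact pow_ne_zero 2 hq.ne_zero hPn.symm

end split

section arith
variable {p : ℕ} [Fact p.Prime]

lemma legendre_eq (hp3 : p % 4 = 3) {q : ℕ} [Fact q.Prime] (hq2 : q ≠ 2) :
    legendreSym q (-p : ℤ) = legendreSym p q := by
  have hp2 : p ≠ 2 := by rintro rfl; omega
  have h1 : (-p : ℤ) = (-1) * (p : ℤ) := by ring
  rw [h1, legendreSym.mul, legendreSym.quadratic_reciprocity' hp2 hq2, legendreSym.at_neg_one hq2,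
    ZMod.χ₄_eq_neg_one_pow ((Fact.out : q.Prime).eq_two_or_odd.resolve_left hq2), pow_mul]
  have h2 : Odd (p / 2) := by rw [Nat.odd_iff]; omega
  rw [h2.neg_one_pow, ← mul_assoc, ← mul_pow]; simp

lemma exists_root (hp3 : p % 4 = 3) {q : ℕ} (hq : q.Prime) {m : ℤ} (hm : 4 * m = p + 1)
    (h : legendreSym p q = 1) : ∃ b : ℤ, (q : ℤ) ∣ b ^ 2 - b + m ∧ ¬ (q : ℤ) ∣ 1 - 2 * b := by
  have : Fact q.Prime := ⟨hq⟩
  have hqp : q ≠ p := by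
    rintro rfl
    rw [(legendreSym.eq_zero_iff q q).mpr (by simp)] at h; omega
  have hp2 : p ≠ 2 := by rintro rfl; omega
  by_cases hq2 : q = 2
  · subst hq2
    have h' := h
    rw [Nat.cast_ofNat, legendreSym.at_two hp2] at h'
    rw [ZMod.χ₈_nat_eq_if_mod_eight] at h'
    refine ⟨0, ?_, by norm_num⟩
    split_ifs at h' <;> omega
  · rw [← legendre_eq hp3 hq2] at h
    have hne : ((-p : ℤ) : ZMod q) ≠ 0 := by
      intro h0; rw [(legendreSym.eq_zero_iff q _).mpr h0] at h; omega
    obtain ⟨c, hc⟩ := (legendreSym.eq_one_iff q hne).mp h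
    obtain ⟨c, rfl⟩ := ZMod.intCast_surjective c
    have hc' : (q : ℤ) ∣ c ^ 2 + p := by
      rw [← ZMod.intCast_zmod_eq_zero_iff_dvd]; push_cast at hc ⊢; rw [sq, ← hc]; ring
    have hqodd : (q : ℤ) % 2 = 1 := by
      have := hq.eq_two_or_odd.resolve_left hq2; omega
    -- make c odd
    obtain ⟨d, hd, hd2⟩ : ∃ d : ℤ, (q : ℤ) ∣ (2 * d - 1) ^ 2 + p ∧ True := by
      rcases Int.emod_two_eq_zero_or_one c with h0 | h0
      · refine ⟨(c + q + 1) / 2, ?_, trivial⟩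
        have : 2 * ((c + q + 1) / 2) - 1 = c + q := by omega
        rw [this]
        have : (c + q) ^ 2 + (p : ℤ) = c ^ 2 + p + q * (2 * c + q) := by ring
        rw [this]; exact dvd_add hc' (dvd_mul_right _ _)
      · refine ⟨(c + 1) / 2, ?_, trivial⟩
        have : 2 * ((c + 1) / 2) - 1 = c := by omega
        rwa [this]
    have hqpr := Nat.prime_iff_prime_int.mp hq
    refine ⟨d, ?_, ?_⟩
    · have : (q : ℤ) ∣ 4 * (d ^ 2 - d + m) := by
        have e : 4 * (d ^ 2 - d + m) = (2 * d - 1) ^ 2 + p := by linear_combination hm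
        rwa [e]
      refine (hqpr.dvd_or_dvd this).resolve_left ?_
      intro h4
      have : (q : ℤ) ∣ 2 ^ 2 := by simpa using h4
      have := hqpr.dvd_of_dvd_pow this
      have := Int.le_of_dvd (by norm_num) this
      have := hq.two_le
      omega
    · intro h4
      have h5 : (q : ℤ) ∣ p := by
        have e : (p : ℤ) = ((2 * d - 1) ^ 2 + p) - (1 - 2 * d) * (1 - 2 * d) := by ring
        rw [e]; exact dvd_sub hd (Dvd.dvd.mul_right h4 _)
      have h6 := (Nat.prime_dvd_prime_iff_eq hq Fact.out).mp (Int.natCast_dvd_natCast.mp h5)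
      exact hqp h6

lemma no_root (hp3 : p % 4 = 3) {q : ℕ} (hq : q.Prime) {m : ℤ} (hm : 4 * m = p + 1)
    (h : legendreSym p q = -1) (b : ℤ) : ¬ (q : ℤ) ∣ b ^ 2 - b + m := by
  have : Fact q.Prime := ⟨hq⟩
  have hp2 : p ≠ 2 := by rintro rfl; omega
  intro hb
  by_cases hq2 : q = 2
  · subst hq2
    rw [Nat.cast_ofNat, legendreSym.at_two hp2, ZMod.χ₈_nat_eq_if_mod_eight] at h
    have : (b ^ 2 - b) % 2 = 0 := by
      rcases Int.emod_two_eq_zero_or_one b with h0 | h0 <;>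
        simp [sq, Int.sub_emod, Int.mul_emod, h0]
    split_ifs at h <;> omega
  · rw [← legendre_eq hp3 hq2] at h
    rw [legendreSym.eq_neg_one_iff] at h
    apply h
    refine ⟨((2 * b - 1 : ℤ) : ZMod q), ?_⟩
    have : (q : ℤ) ∣ (2 * b - 1) * (2 * b - 1) + p := by
      have e : (2 * b - 1) * (2 * b - 1) + p = 4 * (b ^ 2 - b + m) := by linear_combination -hm
      rw [e]; exact Dvd.dvd.mul_left hb _
    rw [← ZMod.intCast_zmod_eq_zero_iff_dvd] at this
    push_cast at this ⊢
    linear_combination -this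
end arith

section count
variable {p : ℕ} [Fact p.Prime]
variable {O : Type*} [CommRing O] [IsDedekindDomain O] [Module.Free ℤ O] [Module.Finite ℤ O]

lemma rcount_prime_pow [CharZero O] (hp3 : p % 4 = 3) (h2 : Module.finrank ℤ O = 2) {ω : O} {m : ℤ}
    (hm : 4 * m = p + 1) (hω : ω ^ 2 = ω - m)
    (tr : O →ₗ[ℤ] ℤ) (tr1 : tr 1 = 2) (trω : tr ω = 1) {q : ℕ} (hq : q.Prime) (e : ℕ) :
    (rcount O (q ^ e) : ℤ) = ∑ i ∈ range (e + 1), (legendreSym p q) ^ i := by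
  by_cases h0 : ((q : ℤ) : ZMod p) = 0
  · have hl : legendreSym p q = 0 := (legendreSym.eq_zero_iff p q).mpr h0
    rw [hl]
    have hqp : q = p := by
      rw [Int.cast_natCast, ZMod.natCast_eq_zero_iff] at h0
      exact ((Nat.prime_dvd_prime_iff_eq Fact.out hq).mp h0).symm
    subst hqp
    have hmO : (4 * m : O) = q + 1 := by exact_mod_cast congrArg (Int.cast : ℤ → O) hm
    have hsq : Ideal.span {(q : O)} = (Ideal.span {2 * ω - 1}) ^ 2 := by
      rw [Ideal.span_singleton_pow]
      have : (2 * ω - 1) ^ 2 = -(q : O) := by linear_combination 4 * hω - hmO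
      rw [this, Ideal.span_singleton_neg]
    have hN := congrArg Ideal.absNorm hsq
    rw [map_pow, Ideal.absNorm_span_natCast, h2] at hN
    have hN' := (Nat.pow_left_injective two_ne_zero hN).symm
    rw [rcount_ram hq hN' hsq e, Finset.sum_range_succ']
    simp
  · rcases legendreSym.eq_one_or_neg_one p h0 with h1 | h1
    · obtain ⟨b, hb, hb2⟩ := exists_root hp3 hq hm h1
      rw [split_case h2 hω tr tr1 trω hq b hb hb2, h1]; simp
    · rw [inert_case h2 hω hq (no_root hp3 hq hm h1), h1, neg_one_geom_sum]
      simp only [Nat.even_add_one]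
      split_ifs <;> simp

lemma rcount_eq [CharZero O] (hp3 : p % 4 = 3) (h2 : Module.finrank ℤ O = 2) {ω : O} {m : ℤ}
    (hm : 4 * m = p + 1) (hω : ω ^ 2 = ω - m)
    (tr : O →ₗ[ℤ] ℤ) (tr1 : tr 1 = 2) (trω : tr ω = 1) {n : ℕ} (hn : n ≠ 0) :
    (rcount O n : ℤ) = ∑ d ∈ n.divisors, legendreSym p d := by
  let f : ArithmeticFunction ℤ := ⟨fun n => if n = 0 then 0 else rcount O n, by simp⟩
  let c : ArithmeticFunction ℤ := ⟨fun n => legendreSym p n, by simp⟩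
  let z : ArithmeticFunction ℤ := (ArithmeticFunction.zeta : ArithmeticFunction ℤ)
  have hf : f.IsMultiplicative := by
    rw [ArithmeticFunction.IsMultiplicative.iff_ne_zero]
    refine ⟨by simp [f, rcount_one], fun {m n} hm hn hmn => ?_⟩
    simp only [f, ArithmeticFunction.coe_mk, hm, hn, mul_ne_zero hm hn, if_false]
    rw [rcount_mul hmn hm hn]; push_cast; rfl
  have hc : c.IsMultiplicative := by
    rw [ArithmeticFunction.IsMultiplicative.iff_ne_zero]
    refine ⟨by simp [c], fun {m n} hm hn hmn => ?_⟩
    simp only [c, ArithmeticFunction.coe_mk]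
    push_cast; rw [legendreSym.mul]
  have hg : (c * z).IsMultiplicative := hc.mul ArithmeticFunction.isMultiplicative_zeta.natCast
  have hfg : f = c * z := by
    rw [ArithmeticFunction.IsMultiplicative.eq_iff_eq_on_prime_powers _ hf _ hg]
    intro q e hq
    rw [ArithmeticFunction.coe_mul_zeta_apply, Nat.sum_divisors_prime_pow hq]
    simp only [f, c, ArithmeticFunction.coe_mk, pow_eq_zero_iff', hq.ne_zero, false_and, if_false]
    rw [rcount_prime_pow hp3 h2 hm hω tr tr1 trω hq]
    refine Finset.sum_congr rfl fun i hi => ?_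
    clear hi
    induction i with
    | zero => simp
    | succ i ih => rw [pow_succ, pow_succ, ih]; push_cast; rw [legendreSym.mul]
  have := DFunLike.congr_fun hfg n
  rw [ArithmeticFunction.coe_mul_zeta_apply] at this
  simpa [f, c, hn] using this
end count

section analysis
open Filter Topology

lemma by_parts (c g : ℕ → ℝ) (N : ℕ) : ∑ n ∈ range N, c n * g n =
    (∑ n ∈ range N, c n) * g N + ∑ n ∈ range N, (∑ k ∈ range (n + 1), c k) * (g n - g (n + 1)) := by
  induction N with
  | zero => simp
  | succ N ih =>
    rw [Finset.sum_range_succ, ih, Finset.sum_range_succ (fun n => (∑ k ∈ range (n + 1), c k) * (g n - g (n + 1))),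
      Finset.sum_range_succ c]
    ring

lemma g_diff {s : ℝ} (h1 : 1 ≤ s) (h2 : s ≤ 2) (n : ℕ) :
    |(n : ℝ) ^ (-s) - ((n + 1 : ℕ) : ℝ) ^ (-s)| ≤ if n = 0 then 1 else 2 / (n : ℝ) ^ 2 := by
  split_ifs with h0
  · subst h0
    simp [Real.zero_rpow (by linarith : -s ≠ 0)]
  have hn : (1 : ℝ) ≤ n := by exact_mod_cast Nat.one_le_iff_ne_zero.mpr h0
  have hnp : (0 : ℝ) < n := by linarith
  have hmono : ((n + 1 : ℕ) : ℝ) ^ (-s) ≤ (n : ℝ) ^ (-s) :=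
    Real.rpow_le_rpow_of_nonpos hnp (by push_cast; linarith) (by linarith)
  rw [abs_of_nonneg (by linarith)]
  -- (n+1)^(-s) = n^(-s) (1+1/n)^(-s)
  have hfac : ((n + 1 : ℕ) : ℝ) ^ (-s) = (n : ℝ) ^ (-s) * (1 + 1 / (n:ℝ)) ^ (-s) := by
    rw [← Real.mul_rpow hnp.le (by positivity)]; congr 1; push_cast; field_simp
  have hB : 1 - s * (1 / (n : ℝ)) ≤ (1 + 1 / (n:ℝ)) ^ (-s) := by
    have hpos : 0 < (1 + 1 / (n:ℝ)) := by positivity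
    have h := one_add_mul_self_le_rpow_one_add (s := -(1 / ((n : ℝ) + 1))) (by
      have : 1 / ((n : ℝ) + 1) ≤ 1 := by rw [div_le_one (by positivity)]; linarith
      linarith) h1
    have e : 1 + -(1 / ((n : ℝ) + 1)) = (1 + 1 / (n:ℝ))⁻¹ := by field_simp; ring
    rw [e, Real.inv_rpow hpos.le, ← Real.rpow_neg hpos.le] at h
    have : 1 / ((n : ℝ) + 1) ≤ 1 / n := by gcongr; linarith
    have : s * (1 / ((n : ℝ) + 1)) ≤ s * (1 / n) := by gcongr
    linarith
  have hle : (n : ℝ) ^ (-s) ≤ 1 / n := by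
    rw [one_div, ← Real.rpow_neg_one]
    exact Real.rpow_le_rpow_of_exponent_le hn (by linarith)
  rw [hfac]
  calc (n : ℝ) ^ (-s) - (n : ℝ) ^ (-s) * (1 + 1 / (n:ℝ)) ^ (-s) 
      = (n : ℝ) ^ (-s) * (1 - (1 + 1 / (n:ℝ)) ^ (-s)) := by ring
    _ ≤ (1 / n) * (2 * (1 / n)) := by
        have hs : s * (1 / (n : ℝ)) ≤ 2 * (1 / n) := by gcongr
        exact mul_le_mul hle (by linarith) (by
          have : (1 + 1 / (n:ℝ)) ^ (-s) ≤ 1 := Real.rpow_le_one_of_one_le_of_nonpos (by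
            have : (0:ℝ) ≤ 1 / n := by positivity
            linarith) (by linarith)
          linarith) (by positivity)
    _ = _ := by field_simp


lemma bd_summable (B : ℝ) : Summable (fun n : ℕ => B * (if n = 0 then 1 else 2 / (n : ℝ) ^ 2)) := by
  apply Summable.mul_left
  have h : Summable (fun n : ℕ => 2 / (n : ℝ) ^ 2) := by
    simpa [div_eq_mul_inv] using (Real.summable_nat_pow_inv.mpr one_lt_two).mul_left 2
  refine (h.add (summable_of_hasFiniteSupport (f := fun n : ℕ => if n = 0 then (1:ℝ) else 0) ?_)).congr ?_
  · refine (Set.finite_singleton 0).subset ?_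
    intro n hn; by_contra h; simp at h; simp [h] at hn
  · intro n; by_cases h : n = 0 <;> simp [h]

/-- the summed-by-parts series -/
noncomputable def Ysum (c : ℕ → ℝ) (s : ℝ) : ℝ :=
  ∑' n : ℕ, (∑ k ∈ range (n + 1), c k) * ((n : ℝ) ^ (-s) - ((n + 1 : ℕ) : ℝ) ^ (-s))

lemma term_bd {c : ℕ → ℝ} {B : ℝ} (hB : ∀ N, |∑ k ∈ range N, c k| ≤ B) {s : ℝ} (h1 : 1 ≤ s) (h2 : s ≤ 2)
    (n : ℕ) : ‖(∑ k ∈ range (n + 1), c k) * ((n : ℝ) ^ (-s) - ((n + 1 : ℕ) : ℝ) ^ (-s))‖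
      ≤ B * (if n = 0 then 1 else 2 / (n : ℝ) ^ 2) := by
  rw [norm_mul, Real.norm_eq_abs, Real.norm_eq_abs]
  exact mul_le_mul (hB _) (g_diff h1 h2 n) (abs_nonneg _) ((abs_nonneg _).trans (hB 0))

lemma tendsto_partial {c : ℕ → ℝ} {B : ℝ} (hB : ∀ N, |∑ k ∈ range N, c k| ≤ B) {s : ℝ} (h1 : 1 ≤ s) (h2 : s ≤ 2) :
    Tendsto (fun N => ∑ n ∈ range N, c n * (n : ℝ) ^ (-s)) atTop (𝓝 (Ysum c s)) := by
  have hs : Summable (fun n : ℕ => (∑ k ∈ range (n + 1), c k) * ((n : ℝ) ^ (-s) - ((n + 1 : ℕ) : ℝ) ^ (-s))) :=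
    Summable.of_norm_bounded (bd_summable B) (term_bd hB h1 h2)
  have ht := hs.hasSum.tendsto_sum_nat
  have h0 : Tendsto (fun N : ℕ => (∑ n ∈ range N, c n) * (N : ℝ) ^ (-s)) atTop (𝓝 0) := by
    have hz : Tendsto (fun N : ℕ => B * (N : ℝ) ^ (-s)) atTop (𝓝 0) := by
      simpa using ((tendsto_rpow_neg_atTop (by linarith : 0 < s)).comp tendsto_natCast_atTop_atTop).const_mul B
    refine squeeze_zero_norm (fun N => ?_) hz
    rw [norm_mul, Real.norm_eq_abs, Real.norm_eq_abs, abs_of_nonneg (a := (N : ℝ) ^ (-s)) (by positivity)]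
    exact mul_le_mul_of_nonneg_right (hB N) (by positivity)
  have := h0.add ht
  rw [zero_add] at this
  refine this.congr fun N => ?_
  rw [by_parts c (fun n : ℕ => (n : ℝ) ^ (-s)) N]

lemma tendsto_Ysum {c : ℕ → ℝ} {B : ℝ} (hB : ∀ N, |∑ k ∈ range N, c k| ≤ B) :
    Tendsto (Ysum c) (𝓝[>] 1) (𝓝 (Ysum c 1)) := by
  unfold Ysum
  refine tendsto_tsum_of_dominated_convergence (bd_summable B) ?_ ?_
  · intro n
    refine Tendsto.mono_left ?_ nhdsWithin_le_nhds
    refine Tendsto.const_mul _ (Tendsto.sub ?_ ?_)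
    · by_cases hn : n = 0
      · subst hn
        have : (fun s : ℝ => ((0:ℕ) : ℝ) ^ (-s)) =ᶠ[𝓝 1] fun _ => 0 := by
          filter_upwards [lt_mem_nhds (zero_lt_one (α := ℝ))] with s hs
          rw [Nat.cast_zero, Real.zero_rpow (by linarith)]
        rw [tendsto_congr' this]; simp
      · exact (Real.continuousAt_const_rpow (by exact_mod_cast hn)).tendsto.comp
          (continuous_neg.tendsto 1)
    · exact (Real.continuousAt_const_rpow (by positivity)).tendsto.comp
          (continuous_neg.tendsto 1)
  · filter_upwards [Ioo_mem_nhdsGT (one_lt_two (α := ℝ))] with s hs n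
    exact term_bd hB hs.1.le hs.2.le n

lemma abel_value {c : ℕ → ℝ} {B : ℝ} (hB : ∀ N, |∑ k ∈ range N, c k| ≤ B) :
    Tendsto (fun x : ℝ => ∑' n : ℕ, (c n / n) * x ^ n) (𝓝[<] 1) (𝓝 (Ysum c 1)) := by
  apply Real.tendsto_tsum_powerSeries_nhdsWithin_lt
  refine (tendsto_partial hB le_rfl one_le_two).congr fun N => ?_
  refine Finset.sum_congr rfl fun n _ => ?_
  rw [Real.rpow_neg_one, div_eq_mul_inv]

end analysis

section value
open Filter Topology

lemma log_one_sub_exp {φ : ℝ} (h0 : 0 < φ) (h1 : φ < 2 * Real.pi) :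
    Complex.log (1 - Complex.exp (φ * Complex.I)) =
      (Real.log (2 * Real.sin (φ / 2)) : ℝ) + ((φ - Real.pi) / 2 : ℝ) * Complex.I := by
  have hs : 0 < Real.sin (φ / 2) := Real.sin_pos_of_pos_of_lt_pi (by linarith) (by linarith)
  have key : 1 - Complex.exp (φ * Complex.I) =
      ((2 * Real.sin (φ / 2) : ℝ) : ℂ) * Complex.exp (((φ - Real.pi) / 2 : ℝ) * Complex.I) := by
    have e1 : Complex.exp (((φ - Real.pi) / 2 : ℝ) * Complex.I) = Complex.exp ((φ/2 : ℝ) * Complex.I) * (-Complex.I) := by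
      have : (((φ - Real.pi) / 2 : ℝ) : ℂ) * Complex.I = (φ/2 : ℝ) * Complex.I + (-(Real.pi / 2 * Complex.I)) := by
        push_cast; ring
      rw [this, Complex.exp_add, Complex.exp_neg, Complex.exp_pi_div_two_mul_I, Complex.inv_I]
    have e2 : Complex.exp (φ * Complex.I) = Complex.exp ((φ/2 : ℝ) * Complex.I) ^ 2 := by
      rw [← Complex.exp_nat_mul]; congr 1; push_cast; ring
    rw [e1, e2, Complex.exp_mul_I, ← Complex.ofReal_cos, ← Complex.ofReal_sin]
    have h := Real.sin_sq_add_cos_sq (φ / 2)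
    have h' : (Real.sin (φ/2) : ℂ) ^ 2 + (Real.cos (φ/2) : ℂ) ^ 2 = 1 := by exact_mod_cast h
    push_cast at h' ⊢
    linear_combination (-1 : ℂ) * h' + (Complex.sin (φ/2) ^ 2) * Complex.I_sq
  rw [key, Complex.log_ofReal_mul (by positivity) (Complex.exp_ne_zero _), Complex.log_exp]
  · simp only [Complex.mul_I_im, Complex.ofReal_re]; linarith
  · simp only [Complex.mul_I_im, Complex.ofReal_re]; linarith

variable {p : ℕ} [hpF : Fact p.Prime]

lemma leg_nat (n : ℕ) : legendreSym p n = quadraticChar (ZMod p) (n : ZMod p) := by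
  rw [legendreSym]; simp

lemma leg_sum_period (hp2 : p ≠ 2) : ∑ k ∈ range p, legendreSym p k = 0 := by
  have h := quadraticChar_sum_zero (F := ZMod p) (by rwa [ZMod.ringChar_zmod_n])
  rw [← h]
  refine Finset.sum_bij (fun k _ => (k : ZMod p)) (fun _ _ => mem_univ _) ?_ ?_ (fun k _ => leg_nat k)
  · intro a ha b hb hab
    rw [ZMod.natCast_eq_natCast_iff'] at hab
    rwa [Nat.mod_eq_of_lt (mem_range.mp ha), Nat.mod_eq_of_lt (mem_range.mp hb)] at hab
  · intro b _
    exact ⟨b.val, mem_range.mpr (ZMod.val_lt b), by simp⟩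

lemma leg_abs_le (n : ℕ) : |legendreSym p n| ≤ 1 := by
  by_cases h : ((n : ℤ) : ZMod p) = 0
  · rw [(legendreSym.eq_zero_iff p n).mpr h]; simp
  · rcases legendreSym.eq_one_or_neg_one p h with h | h <;> rw [h] <;> simp

lemma leg_sum_bd (hp2 : p ≠ 2) (N : ℕ) : |∑ k ∈ range N, (legendreSym p k : ℝ)| ≤ p := by
  have h1 : ∀ N, ∑ k ∈ range (p + N), legendreSym p k = ∑ k ∈ range N, legendreSym p k := by
    intro N
    rw [Finset.sum_range_add, leg_sum_period hp2, zero_add]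
    refine Finset.sum_congr rfl fun k _ => ?_
    rw [leg_nat, leg_nat]; simp
  have h2 : |∑ k ∈ range N, legendreSym p k| ≤ p := by
    induction N using Nat.strong_induction_on with
    | _ N ih =>
      by_cases hN : N < p
      · refine (Finset.abs_sum_le_sum_abs _ _).trans ((Finset.sum_le_sum (fun k _ => leg_abs_le k)).trans ?_)
        simp; omega
      · have : N = p + (N - p) := by omega
        rw [this, h1]
        exact ih _ (by have := hpF.out.pos; omega)
  exact_mod_cast h2

variable (p) in
noncomputable def qc : MulChar (ZMod p) ℂ := (quadraticChar (ZMod p)).ringHomComp (Int.castRingHom ℂ)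

lemma qc_apply (a : ZMod p) : qc p a = (quadraticChar (ZMod p) a : ℂ) := by simp [qc]

lemma qc_quad : (qc p).IsQuadratic := by
  exact (quadraticChar_isQuadratic (ZMod p)).comp _

lemma qc_ne_one (hp2 : p ≠ 2) : qc p ≠ 1 := by
  intro h
  apply quadraticChar_ne_one (F := ZMod p) (by rwa [ZMod.ringChar_zmod_n])
  ext a
  have := congrArg (fun f => f (a : ZMod p)) h
  simp only [qc_apply] at this
  rw [MulChar.one_apply_coe] at this ⊢
  exact_mod_cast this

lemma gauss_mul (hp2 : p ≠ 2) (n : ℕ) : gaussSum (qc p) ZMod.stdAddChar * qc p (n : ZMod p) =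
    ∑ a : ZMod p, qc p a * (ZMod.stdAddChar a) ^ n := by
  have e : ∀ a : ZMod p, (ZMod.stdAddChar a : ℂ) ^ n = ZMod.stdAddChar ((n : ZMod p) * a) := by
    intro a
    rw [← AddChar.map_nsmul_eq_pow, nsmul_eq_mul]
  simp_rw [e]
  by_cases hn : (n : ZMod p) = 0
  · rw [hn]
    simp only [zero_mul, AddChar.map_zero_eq_one, mul_one]
    rw [MulChar.sum_eq_zero_of_ne_one (qc_ne_one hp2), MulChar.map_zero, mul_zero]
  · have h := gaussSum_mulShift (qc p) (ZMod.stdAddChar (N := p)) (Units.mk0 _ hn)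
    rw [Units.val_mk0] at h
    have hsq : qc p (n : ZMod p) * qc p (n : ZMod p) = 1 := by
      rw [← sq, qc_apply]
      exact_mod_cast quadraticChar_sq_one hn
    rw [← h, gaussSum]
    simp only [AddChar.mulShift_apply]
    linear_combination (∑ a : ZMod p, qc p a * ZMod.stdAddChar ((n : ZMod p) * a)) * hsq

lemma std_eq (a : ZMod p) : (ZMod.stdAddChar a : ℂ) =
    Complex.exp ((2 * Real.pi * a.val / p : ℝ) * Complex.I) := by
  rw [ZMod.stdAddChar_apply, ZMod.toCircle_apply]
  congr 1; push_cast; ring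

variable (p) in
noncomputable def Tsum : ℤ := ∑ a : ZMod p, quadraticChar (ZMod p) a * (a.val : ℤ)

lemma gauss_A (hp3 : p % 4 = 3) :
    gaussSum (qc p) ZMod.stdAddChar * (Ysum (fun n => (legendreSym p n : ℝ)) 1 : ℂ) =
      -(Complex.I * Real.pi / p * (Tsum p : ℂ)) := by
  have hp2 : p ≠ 2 := by rintro rfl; omega
  have hpp : (0 : ℝ) < p := by exact_mod_cast hpF.out.pos
  set G := gaussSum (qc p) ZMod.stdAddChar
  have hA := abel_value (c := fun n => (legendreSym p n : ℝ)) (leg_sum_bd hp2)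
  have hA' := ((Complex.continuous_ofReal.tendsto _).comp hA).const_mul G
  have hx : ∀ x : ℝ, 0 < x → x < 1 → G * ((∑' n : ℕ, ((legendreSym p n : ℝ) / n) * x ^ n : ℝ) : ℂ) =
      ∑ a : ZMod p, qc p a * (-Complex.log (1 - ZMod.stdAddChar a * x)) := by
    intro x hx0 hx1
    have hs : ∀ a : ZMod p, HasSum (fun n : ℕ => qc p a * ((ZMod.stdAddChar a * x) ^ n / n))
        (qc p a * (-Complex.log (1 - ZMod.stdAddChar a * x))) := by
      intro a
      apply HasSum.mul_left
      apply Complex.hasSum_taylorSeries_neg_log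
      rw [norm_mul, std_eq, Complex.norm_exp_ofReal_mul_I, one_mul, Complex.norm_real,
        Real.norm_eq_abs, abs_of_pos hx0]
      exact hx1
    have hs2 := hasSum_sum (s := Finset.univ) (fun a _ => hs a)
    rw [← hs2.tsum_eq, Complex.ofReal_tsum, ← tsum_mul_left]
    congr 1; ext n
    have h := gauss_mul (p := p) hp2 n
    rw [qc_apply, ← leg_nat] at h
    have : ∑ a : ZMod p, qc p a * ((ZMod.stdAddChar a * x) ^ n / n) =
        (∑ a : ZMod p, qc p a * (ZMod.stdAddChar a) ^ n) * (x ^ n / n) := by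
      rw [Finset.sum_mul]; refine Finset.sum_congr rfl fun a _ => ?_; ring
    rw [this, ← h]; push_cast; ring
  have hstd : ∀ a : ZMod p, a ≠ 0 → 0 < 2 * Real.pi * a.val / p ∧ 2 * Real.pi * a.val / p < 2 * Real.pi := by
    intro a ha
    have h1 : (0 : ℝ) < a.val := by exact_mod_cast (ZMod.val_pos.mpr ha)
    have h2 : (a.val : ℝ) < p := by exact_mod_cast ZMod.val_lt a
    refine ⟨by positivity, ?_⟩
    rw [div_lt_iff₀ hpp]
    have := Real.pi_pos
    gcongr
  have hlim : Tendsto (fun x : ℝ => ∑ a : ZMod p, qc p a * (-Complex.log (1 - ZMod.stdAddChar a * x)))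
      (𝓝[<] 1) (𝓝 (∑ a : ZMod p, qc p a * (-Complex.log (1 - ZMod.stdAddChar a)))) := by
    refine tendsto_finsetSum _ fun a _ => ?_
    by_cases ha : a = 0
    · subst ha
      simp only [MulChar.map_zero, zero_mul]
      exact tendsto_const_nhds
    · refine Tendsto.const_mul _ (Tendsto.neg ?_)
      refine Tendsto.mono_left ?_ nhdsWithin_le_nhds
      have hm : (1 - ZMod.stdAddChar a : ℂ) ∈ Complex.slitPlane := by
        rw [Complex.mem_slitPlane_iff_arg]
        have hl := log_one_sub_exp (hstd a ha).1 (hstd a ha).2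
        rw [← std_eq] at hl
        have him := congrArg Complex.im hl
        rw [Complex.log_im, Complex.add_im, Complex.ofReal_im, Complex.mul_I_im, Complex.ofReal_re, zero_add] at him
        refine ⟨?_, ?_⟩
        · rw [him]
          have := (hstd a ha).2
          have := Real.pi_pos
          intro h; linarith
        · intro h0
          have hre := congrArg Complex.re (sub_eq_zero.mp h0)
          have h1 := std_eq a
          rw [← sub_eq_zero.mp h0, eq_comm, Complex.exp_eq_one_iff] at h1
          obtain ⟨n, hn⟩ := h1
          have h3 := congrArg Complex.im hn
          have e : (n : ℂ) * (2 * Real.pi * Complex.I) = ((n * (2 * Real.pi) : ℝ) : ℂ) * Complex.I := by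
            push_cast; ring
          rw [e, Complex.mul_I_im, Complex.mul_I_im, Complex.ofReal_re, Complex.ofReal_re] at h3
          have hh := hstd a ha
          rw [h3] at hh
          have hpi := Real.pi_pos
          have n0 : (0 : ℝ) < n := by
            by_contra hc; push Not at hc; nlinarith [hh.1]
          have n1 : (n : ℝ) < 1 := by
            by_contra hc; push Not at hc; nlinarith [hh.2]
          have n0' : 0 < n := by exact_mod_cast n0
          have n1' : n < 1 := by exact_mod_cast n1
          omega
      have : Tendsto (fun x : ℝ => (1 - ZMod.stdAddChar a * (x : ℂ))) (𝓝 1) (𝓝 (1 - ZMod.stdAddChar a)) := by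
        have hc : Continuous (fun x : ℝ => (1 - ZMod.stdAddChar a * (x : ℂ))) := by fun_prop
        simpa using hc.tendsto 1
      exact this.clog hm
  have hev : ∀ᶠ x : ℝ in 𝓝[<] 1, G * ((∑' n : ℕ, ((legendreSym p n : ℝ) / n) * x ^ n : ℝ) : ℂ) =
      ∑ a : ZMod p, qc p a * (-Complex.log (1 - ZMod.stdAddChar a * x)) := by
    filter_upwards [Ioo_mem_nhdsLT (zero_lt_one (α := ℝ))] with x hx'
    exact hx x hx'.1 hx'.2
  have heq := tendsto_nhds_unique (hA'.congr' hev) hlim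
  rw [heq]
  -- evaluate
  let L : ZMod p → ℝ := fun a => Real.log (2 * Real.sin (Real.pi * a.val / p))
  have hlog : ∀ a : ZMod p, qc p a * (-Complex.log (1 - ZMod.stdAddChar a)) =
      -(qc p a * (L a : ℂ)) - (Complex.I * Real.pi / p) * (qc p a * (a.val : ℂ)) + (Real.pi / 2 * Complex.I) * qc p a := by
    intro a
    by_cases ha : a = 0
    · have hz : qc p a = 0 := by rw [ha]; exact MulChar.map_zero _
      have hz' : qc p (-a) = 0 := by rw [ha, neg_zero]; exact MulChar.map_zero _
      simp [hz, hz']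
    · rw [std_eq, log_one_sub_exp (hstd a ha).1 (hstd a ha).2]
      have : 2 * Real.pi * a.val / p / 2 = Real.pi * a.val / p := by ring
      rw [this]
      simp only [L]; push_cast; ring
  have hneg : quadraticChar (ZMod p) (-1) = -1 := by
    have h1 : legendreSym p (-1) = ZMod.χ₄ p := legendreSym.at_neg_one hp2
    rw [ZMod.χ₄_nat_three_mod_four hp3, legendreSym] at h1
    simpa using h1
  have hL0 : ∑ a : ZMod p, qc p a * (L a : ℂ) = 0 := by
    have h1 : ∑ a : ZMod p, qc p a * (L a : ℂ) = ∑ a : ZMod p, qc p (-a) * (L (-a) : ℂ) :=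
      (Equiv.sum_comp (Equiv.neg (ZMod p)) (fun a => qc p a * (L a : ℂ))).symm
    have h2 : ∀ a : ZMod p, qc p (-a) * (L (-a) : ℂ) = -(qc p a * (L a : ℂ)) := by
      intro a
      by_cases ha : a = 0
      · have hz : qc p a = 0 := by rw [ha]; exact MulChar.map_zero _
        have hz' : qc p (-a) = 0 := by rw [ha, neg_zero]; exact MulChar.map_zero _
        simp [hz, hz']
      · have e1 : qc p (-a) = - qc p a := by
          rw [neg_eq_neg_one_mul, map_mul, qc_apply (-1), hneg]; simp
        have e2 : L (-a) = L a := by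
          simp only [L]
          have : NeZero a := ⟨ha⟩
          rw [ZMod.val_neg_of_ne_zero, Nat.cast_sub (ZMod.val_lt a).le]
          have : Real.pi * ((p : ℝ) - a.val) / p = Real.pi - Real.pi * a.val / p := by field_simp
          rw [this, Real.sin_pi_sub]
        rw [e1, e2, neg_mul]
    simp_rw [h2, Finset.sum_neg_distrib] at h1
    exact self_eq_neg.mp h1
  simp_rw [hlog]
  rw [Finset.sum_add_distrib, Finset.sum_sub_distrib, Finset.sum_neg_distrib, hL0, ← Finset.mul_sum,
    ← Finset.mul_sum, MulChar.sum_eq_zero_of_ne_one (qc_ne_one hp2)]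
  have : (Tsum p : ℂ) = ∑ a : ZMod p, qc p a * (a.val : ℂ) := by
    rw [Tsum]; push_cast; simp only [qc_apply]
  rw [this]; ring

lemma A_sq (hp3 : p % 4 = 3) :
    (Ysum (fun n => (legendreSym p n : ℝ)) 1) ^ 2 * p ^ 3 = Real.pi ^ 2 * (Tsum p : ℝ) ^ 2 := by
  have hp2 : p ≠ 2 := by rintro rfl; omega
  have hpp : (p : ℂ) ≠ 0 := by exact_mod_cast hpF.out.ne_zero
  have h := gauss_A (p := p) hp3
  have hG : gaussSum (qc p) ZMod.stdAddChar ^ 2 = qc p (-1) * (Fintype.card (ZMod p) : ℂ) :=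
    gaussSum_sq (qc_ne_one hp2) (qc_quad (p := p)) (ZMod.isPrimitive_stdAddChar p)
  have hneg : quadraticChar (ZMod p) (-1) = -1 := by
    have h1 : legendreSym p (-1) = ZMod.χ₄ p := legendreSym.at_neg_one hp2
    rw [ZMod.χ₄_nat_three_mod_four hp3, legendreSym] at h1
    simpa using h1
  rw [qc_apply, hneg, ZMod.card] at hG
  have h2 := congrArg (· ^ 2) h
  simp only [mul_pow, hG] at h2
  have : ((Ysum (fun n => (legendreSym p n : ℝ)) 1 : ℝ) : ℂ) ^ 2 * p ^ 3 = Real.pi ^ 2 * (Tsum p : ℂ) ^ 2 := by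
    push_cast at h2
    field_simp at h2
    rw [Complex.I_sq] at h2
    linear_combination -h2
  exact_mod_cast this
end value

section finsum
variable {p : ℕ} [hpF : Fact p.Prime]

lemma sum_eq_T (hp3 : p % 4 = 3) (v : ℕ) (hv : orderOf (v : ZMod p) = p - 1)
    (vn : ℤ → ℕ)
    (hvn1 : ∀ n : ℤ, 1 ≤ vn n) (hvn2 : ∀ n : ℤ, vn n ≤ p - 1)
    (hvn0 : vn 0 = 1)
    (hvnrec : ∀ n : ℤ, (vn (n + 1) : ZMod p) = (v : ZMod p) * (vn n : ZMod p)) :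
    2 * (∑ i ∈ Finset.range ((p - 1) / 2), (-1 : ℤ) ^ i * (vn (-(i : ℤ)) : ℤ)) - (p : ℤ) = Tsum p := by
  have hp2 : p ≠ 2 := by rintro rfl; omega
  have hpos := hpF.out.two_le
  have hv0 : (v : ZMod p) ≠ 0 := by
    intro h
    rw [h, orderOf_zero] at hv
    omega
  obtain ⟨m, hm⟩ : ∃ m, p - 1 = 2 * m := ⟨(p - 1) / 2, by omega⟩
  have hmo : Odd m := by rw [Nat.odd_iff]; omega
  rw [show (p - 1) / 2 = m by omega]
  set u : (ZMod p)ˣ := Units.mk0 (v : ZMod p) hv0 with hu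
  have hou : orderOf (u⁻¹) = p - 1 := by
    rw [orderOf_inv, ← orderOf_units, hu, Units.val_mk0, hv]
  set w : ZMod p := ((u⁻¹ : (ZMod p)ˣ) : ZMod p) with hw
  have hvw : (v : ZMod p) * w = 1 := by
    rw [hw, ← Units.val_mk0 hv0, ← hu, Units.mul_inv]
  have how : orderOf w = p - 1 := by rw [hw, orderOf_units, hou]
  have hw0 : w ≠ 0 := Units.ne_zero _
  have hvnw : ∀ i : ℕ, (vn (-(i : ℤ)) : ZMod p) = w ^ i := by
    intro i
    induction i with
    | zero => simp [hvn0]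
    | succ i ih =>
      have h := hvnrec (-((i + 1 : ℕ) : ℤ))
      rw [show (-((i + 1 : ℕ) : ℤ) + 1) = -(i : ℤ) by push_cast; ring, ih] at h
      rw [pow_succ, h]
      linear_combination (-(vn (-((i + 1 : ℕ) : ℤ)) : ZMod p)) * hvw
  have hval : ∀ i : ℕ, (vn (-(i : ℤ))) = (w ^ i).val := by
    intro i
    rw [← hvnw, ZMod.val_natCast, Nat.mod_eq_of_lt]
    have := hvn2 (-(i : ℤ)); omega
  have hwm : w ^ m = -1 := by
    have h1 : (w ^ m) ^ 2 = 1 := by rw [← pow_mul, mul_comm, ← hm, ← how, pow_orderOf_eq_one]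
    rcases mul_self_eq_one_iff.mp ((sq _).symm.trans h1) with h | h
    · have := Nat.le_of_dvd (by omega) (orderOf_dvd_of_pow_eq_one h)
      omega
    · exact h
  have hchi : quadraticChar (ZMod p) w = -1 := by
    rcases quadraticChar_dichotomy hw0 with h | h
    · exfalso
      rw [quadraticChar_one_iff_isSquare hw0, ZMod.euler_criterion p hw0,
        show p / 2 = m by omega, hwm] at h
      haveI : Fact (2 < p) := ⟨by omega⟩
      exact ZMod.neg_one_ne_one h
    · exact h
  have himg : (range (p - 1)).image (fun i => w ^ i) = univ.erase (0 : ZMod p) := by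
    apply Finset.eq_of_subset_of_card_le
    · intro x hx
      obtain ⟨i, _, rfl⟩ := mem_image.mp hx
      simp [hw0]
    · rw [card_erase_of_mem (mem_univ _), card_univ, ZMod.card, card_image_of_injOn, card_range]
      intro i hi j hj hij
      have := pow_injOn_Iio_orderOf (x := u⁻¹) 
      refine this ?_ ?_ ?_
      · rw [hou]; simpa using hi
      · rw [hou]; simpa using hj
      · apply Units.ext; simp only [Units.val_pow_eq_pow_val]; exact hij
  have hT : Tsum p = ∑ i ∈ range (p - 1), (-1 : ℤ) ^ i * ((w ^ i).val : ℤ) := by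
    rw [Tsum, ← Finset.sum_erase univ (a := (0 : ZMod p)) (by simp), ← himg, sum_image]
    · refine sum_congr rfl fun i _ => ?_
      rw [map_pow, hchi]
    · rw [← card_image_iff, himg, card_erase_of_mem (mem_univ _), card_univ, ZMod.card, card_range]
  have halt : ∑ i ∈ range m, (-1 : ℤ) ^ i = 1 := by
    rw [neg_one_geom_sum, if_neg (Nat.not_even_iff_odd.mpr hmo)]
  rw [hT, hm, two_mul m, Finset.sum_range_add]
  have h2 : ∀ i, (-1 : ℤ) ^ (m + i) * ((w ^ (m + i)).val : ℤ) =
      (-1 : ℤ) ^ i * ((w ^ i).val : ℤ) - p * (-1) ^ i := by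
    intro i
    rw [pow_add, pow_add, hwm, hmo.neg_one_pow, neg_one_mul (w ^ i)]
    have : NeZero (w ^ i) := ⟨pow_ne_zero _ hw0⟩
    rw [ZMod.val_neg_of_ne_zero, Nat.cast_sub (ZMod.val_lt _).le]
    ring
  simp_rw [h2, hval]
  rw [sum_sub_distrib, ← mul_sum, halt]
  ring
end finsum

section fieldfacts
variable {F : Type*} [Field F] [NumberField F]
open Polynomial Module

lemma trace_zero {q : ℚ} (hq : 0 < q) (x : F) (hx : x ^ 2 = -(algebraMap ℚ F q)) :
    Algebra.trace ℚ F x = 0 := by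
  have hdeg : (X ^ 2 + C q : ℚ[X]).natDegree = 2 := by compute_degree!
  have hmon : (X ^ 2 + C q : ℚ[X]).Monic := by monicity!
  have hirr : Irreducible (X ^ 2 + C q : ℚ[X]) := by
    apply Polynomial.irreducible_of_degree_le_three_of_not_isRoot
    · rw [hdeg]; simp
    · intro y hy
      simp only [IsRoot.def, eval_add, eval_pow, eval_X, eval_C] at hy
      nlinarith [sq_nonneg y]
  have hmin : (X ^ 2 + C q : ℚ[X]) = minpoly ℚ x := by
    apply minpoly.eq_of_irreducible_of_monic hirr _ hmon
    simp [hx]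
  rw [trace_eq_finrank_mul_minpoly_nextCoeff, ← hmin, nextCoeff_of_natDegree_pos (by rw [hdeg]; norm_num), hdeg]
  simp [coeff_X]

lemma exists_coords {p : ℕ} (hp : 0 < p) (hF2 : Module.finrank ℚ F = 2) (θ : F) (hθ : θ ^ 2 = -(p : F)) :
    (∀ s t : ℚ, (s : F) + t * θ = 0 → s = 0 ∧ t = 0) ∧ ∀ x : F, ∃ a b : ℚ, x = a + b * θ := by
  have hpq : (0 : ℚ) < p := by exact_mod_cast hp
  have h1 : ∀ s t : ℚ, (s : F) + t * θ = 0 → s = 0 ∧ t = 0 := by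
    intro s t hst
    have e : (s : F) ^ 2 + p * (t : F) ^ 2 = 0 := by
      linear_combination ((s : F) - t * θ) * hst + (t : F) ^ 2 * hθ
    have e' : s ^ 2 + p * t ^ 2 = 0 := by exact_mod_cast e
    have ht : t = 0 := by
      by_contra ht
      have : 0 < t ^ 2 := by positivity
      nlinarith [sq_nonneg s]
    subst ht
    refine ⟨?_, rfl⟩
    simpa using e'
  refine ⟨h1, fun x => ?_⟩
  have hli : LinearIndependent ℚ ![(1 : F), θ] := by
    rw [LinearIndependent.pair_iff]
    intro s t hst
    apply h1
    simpa [Rat.smul_def] using hst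
  let b := basisOfLinearIndependentOfCardEqFinrank hli (by simp [hF2])
  refine ⟨b.repr x 0, b.repr x 1, ?_⟩
  have h := b.sum_repr x
  rw [Fin.sum_univ_two] at h
  simp only [b, coe_basisOfLinearIndependentOfCardEqFinrank] at h
  simpa [Rat.smul_def, b] using h.symm

lemma totally_complex {p : ℕ} (hp : 0 < p) (θ : F) (hθ : θ ^ 2 = -(p : F)) : IsTotallyComplex F := by
  refine ⟨fun w => ?_⟩
  rw [← InfinitePlace.not_isReal_iff_isComplex]
  intro hw
  have h := congrArg (InfinitePlace.embedding_of_isReal hw) hθ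
  simp only [map_pow, map_neg, map_natCast] at h
  have hpr : (0 : ℝ) < p := by exact_mod_cast hp
  nlinarith [sq_nonneg (InfinitePlace.embedding_of_isReal hw θ)]

lemma reg_one_s15 (hF2 : Module.finrank ℚ F = 2) (hc : IsTotallyComplex F) :
    InfinitePlace.nrRealPlaces F = 0 ∧ InfinitePlace.nrComplexPlaces F = 1 ∧ Units.regulator F = 1 := by
  classical
  have h1 : InfinitePlace.nrRealPlaces F = 0 := nrRealPlaces_eq_zero_iff.mpr hc
  have h2 : InfinitePlace.nrComplexPlaces F = 1 := by
    have := IsTotallyComplex.finrank F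
    omega
  refine ⟨h1, h2, ?_⟩
  have h3 : Fintype.card (InfinitePlace F) = 1 := by
    rw [InfinitePlace.card_eq_nrRealPlaces_add_nrComplexPlaces, h1, h2]
  have hs : ∀ a b : InfinitePlace F, a = b := Fintype.card_le_one_iff.mp h3.le
  rw [Units.regulator_eq_det']
  have : IsEmpty {w : InfinitePlace F // w ≠ Units.dirichletUnitTheorem.w₀} :=
    ⟨fun w => w.2 (hs _ _)⟩
  rw [Matrix.det_isEmpty, abs_one]

lemma not_dvd_torsion {p : ℕ} (hp : p.Prime) (hp3 : p ≠ 3) (hF2 : Module.finrank ℚ F = 2) (θ : F)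
    (hθ : θ ^ 2 = -(p : F)) {h : ℕ} (hh : h.Prime) (hodd : h ≠ 2) : ¬ h ∣ Units.torsionOrder F := by
  intro hd
  have : Fact h.Prime := ⟨hh⟩
  obtain ⟨x, hx⟩ := exists_prime_orderOf_dvd_card' (G := Units.torsion F) h hd
  set ζ : F := (((x : (𝓞 F)ˣ) : 𝓞 F) : F) with hζ
  have hz : IsPrimitiveRoot ζ h := by
    have h1 : IsPrimitiveRoot x h := hx ▸ IsPrimitiveRoot.orderOf x
    have h2 : IsPrimitiveRoot (x : (𝓞 F)ˣ) h := h1.map_of_injective (f := (Units.torsion F).subtype) Subtype.val_injective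
    have h3 : IsPrimitiveRoot ((x : (𝓞 F)ˣ) : 𝓞 F) h := h2.map_of_injective (f := Units.coeHom (𝓞 F)) Units.val_injective
    exact h3.map_of_injective (f := algebraMap (𝓞 F) F) RingOfIntegers.coe_injective
  have h1 := minpoly.natDegree_le (A := ℚ) ζ
  have hirr := Polynomial.cyclotomic_eq_minpoly_rat hz hh.pos
  rw [← hirr, Polynomial.natDegree_cyclotomic, Nat.totient_prime hh, hF2] at h1
  have h3 : h = 3 := by have := hh.two_le; omega
  subst h3
  have hr := hz.isRoot_cyclotomic hh.pos
  rw [Polynomial.cyclotomic_three] at hr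
  simp only [IsRoot.def, eval_add, eval_pow, eval_X, eval_one] at hr
  obtain ⟨hind, hco⟩ := exists_coords hp.pos hF2 θ hθ
  obtain ⟨a, b, hab⟩ := hco (2 * ζ + 1)
  have hη : (2 * ζ + 1) ^ 2 = -3 := by linear_combination 4 * hr
  rw [hab] at hη
  have h0 := hind (a ^ 2 - p * b ^ 2 + 3) (2 * a * b) (by push_cast; linear_combination hη - (b : F) ^ 2 * hθ)
  have hb : b ≠ 0 := by
    rintro rfl
    nlinarith [h0.1, sq_nonneg a]
  have ha : a = 0 := by
    have := h0.2
    simpa [hb] using this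
  have h4 : (p : ℚ) * b ^ 2 = 3 := by
    have := h0.1; rw [ha] at this; linarith
  have : Fact p.Prime := ⟨hp⟩
  have h5 := congrArg (padicValRat p) h4
  rw [padicValRat.mul (by exact_mod_cast hp.ne_zero) (pow_ne_zero _ hb), padicValRat.pow,
    padicValRat.self hp.one_lt] at h5
  have h6 : padicValRat p 3 = 0 := by
    have : padicValNat p 3 = 0 := padicValNat.eq_zero_of_not_dvd (fun h => hp3 ((Nat.prime_dvd_prime_iff_eq hp Nat.prime_three).mp h))
    have h7 := padicValRat.of_nat (p := p) (n := 3)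
    rw [this] at h7
    exact_mod_cast h7
  rw [h6] at h5
  push_cast at h5
  omega

lemma omega_facts {p : ℕ} (hp : p.Prime) (hp3 : p % 4 = 3) (hF2 : Module.finrank ℚ F = 2) (θ : F)
    (hθ : θ ^ 2 = -(p : F)) : ∃ (ω : 𝓞 F) (m : ℤ), 4 * m = p + 1 ∧ ω ^ 2 = ω - m ∧
      Algebra.trace ℤ (𝓞 F) 1 = 2 ∧ Algebra.trace ℤ (𝓞 F) ω = 1 := by
  obtain ⟨m, hm⟩ : ∃ m : ℤ, 4 * m = p + 1 := ⟨((p : ℤ) + 1) / 4, by omega⟩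
  have hmF : 4 * (m : F) = p + 1 := by exact_mod_cast congrArg (Int.cast : ℤ → F) hm
  have hsq : ((1 + θ) / 2) ^ 2 = (1 + θ) / 2 - (m : F) := by
    linear_combination hθ / 4 + hmF / 4
  have hint : IsIntegral ℤ ((1 + θ) / 2) := by
    refine ⟨X ^ 2 - X + C m, by monicity!, ?_⟩
    rw [← Polynomial.aeval_def]; simp [hsq]
  obtain ⟨ω, hω⟩ : ∃ ω : 𝓞 F, (ω : F) = (1 + θ) / 2 := ⟨⟨_, hint⟩, rfl⟩
  refine ⟨ω, m, hm, ?_, ?_, ?_⟩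
  · apply RingOfIntegers.coe_injective
    simpa [hω] using hsq
  · rw [← map_one (algebraMap ℤ (𝓞 F)), Algebra.trace_algebraMap, RingOfIntegers.rank, hF2]; simp
  · have h := Algebra.coe_trace_int (K := F) ω
    have e : (ω : F) = (1 / 2 : ℚ) • (algebraMap ℚ F 1 + θ) := by
      rw [Rat.smul_def, map_one]
      rw [hω]; push_cast; ring
    rw [e, map_smul, map_add, Algebra.trace_algebraMap, hF2,
      trace_zero (q := p) (by exact_mod_cast hp.pos) θ (by simpa using hθ)] at h
    have h' : (Algebra.trace ℤ (𝓞 F) ω : ℚ) = 1 := by rw [h]; norm_num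
    exact_mod_cast h'

lemma discr_fact {p : ℕ} (hF2 : Module.finrank ℚ F = 2) (ω : 𝓞 F) (m : ℤ) (hm : 4 * m = p + 1)
    (hω : ω ^ 2 = ω - m) (tr1 : Algebra.trace ℤ (𝓞 F) 1 = 2) (trω : Algebra.trace ℤ (𝓞 F) ω = 1) :
    ∃ k : ℤ, discr F * k ^ 2 = -p := by
  let b : Basis (Fin 2) ℤ (𝓞 F) := Module.finBasisOfFinrankEq ℤ (𝓞 F) (by rw [RingOfIntegers.rank, hF2])
  refine ⟨(b.toMatrix ![1, ω]).det, ?_⟩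
  rw [← discr_eq_discr F b, mul_comm, ← Algebra.discr_of_matrix_vecMul, b.toMatrix_map_vecMul,
    Algebra.discr_def, Matrix.det_fin_two]
  have trω2 : Algebra.trace ℤ (𝓞 F) (ω * ω) = 1 - m * 2 := by
    rw [← sq, hω, map_sub, trω, ← tr1, ← smul_eq_mul, ← map_smul, zsmul_one]
  simp [Algebra.traceMatrix_apply, Algebra.traceForm_apply, tr1, trω, trω2]
  linarith
end fieldfacts

section assembly
open Filter Topology
variable {p : ℕ} [hpF : Fact p.Prime]

lemma leg_summable {s : ℝ} (hs : 1 < s) : LSeriesSummable (fun n : ℕ => (legendreSym p n : ℂ)) (s : ℂ) := by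
  refine LSeriesSummable_of_bounded_of_one_lt_re (m := 1) (fun n _ => ?_) (by simpa using hs)
  have h := leg_abs_le (p := p) n
  rw [Complex.norm_intCast]
  exact_mod_cast h

lemma leg_LSeries (hp2 : p ≠ 2) {s : ℝ} (hs : 1 < s) (hs2 : s ≤ 2) :
    LSeries (fun n : ℕ => (legendreSym p n : ℂ)) (s : ℂ) =
      (Ysum (fun n => (legendreSym p n : ℝ)) s : ℂ) := by
  have h1 := (leg_summable (p := p) hs).LSeriesHasSum.tendsto_sum_nat
  have h2 := (Complex.continuous_ofReal.tendsto _).comp (tendsto_partial (leg_sum_bd hp2) hs.le hs2)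
  refine tendsto_nhds_unique h1 (h2.congr fun N => ?_)
  simp only [Function.comp_apply, Complex.ofReal_sum]
  refine Finset.sum_congr rfl fun n _ => ?_
  rw [LSeries.term_def]
  split_ifs with hn
  · subst hn
    simp [Real.zero_rpow (by linarith : -s ≠ 0)]
  · rw [Real.rpow_neg (by positivity), Complex.ofReal_mul, Complex.ofReal_inv,
      Complex.ofReal_cpow (by positivity)]
    simp [div_eq_mul_inv]

lemma zeta_factor {F : Type*} [Field F] [NumberField F]
    (hr : ∀ n : ℕ, n ≠ 0 → (Nat.card {I : Ideal (𝓞 F) // Ideal.absNorm I = n} : ℤ) =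
      ∑ d ∈ n.divisors, legendreSym p d) {s : ℝ} (hs : 1 < s) :
    dedekindZeta F s = LSeries (fun n : ℕ => (legendreSym p n : ℂ)) (s : ℂ) * riemannZeta s := by
  have hs' : 1 < (s : ℂ).re := by simpa using hs
  rw [← LSeries_one_eq_riemannZeta hs', ← LSeries_convolution' (leg_summable hs) (LSeriesSummable_one_iff.mpr hs'),
    dedekindZeta]
  refine LSeries_congr (fun {n} hn => ?_) _
  rw [LSeries.convolution_def]
  have h := congrArg (Int.cast : ℤ → ℂ) (hr n hn)
  push_cast at h
  rw [h]
  simp only [Pi.one_apply, mul_one]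
  exact (Nat.sum_divisorsAntidiagonal (fun d _ => (legendreSym p d : ℂ))).symm

lemma residue_eq_s15 {F : Type*} [Field F] [NumberField F] (hp2 : p ≠ 2)
    (hr : ∀ n : ℕ, n ≠ 0 → (Nat.card {I : Ideal (𝓞 F) // Ideal.absNorm I = n} : ℤ) =
      ∑ d ∈ n.divisors, legendreSym p d) :
    dedekindZeta_residue F = Ysum (fun n => (legendreSym p n : ℝ)) 1 := by
  have h1 := tendsto_sub_one_mul_dedekindZeta_nhdsGT F
  have h2 : Tendsto (fun s : ℝ => ((s : ℂ) - 1) * riemannZeta s) (𝓝[>] 1) (𝓝 1) := by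
    refine riemannZeta_residue_one.comp ?_
    refine tendsto_nhdsWithin_iff.mpr ⟨?_, ?_⟩
    · exact ((Complex.continuous_ofReal.tendsto 1).mono_left nhdsWithin_le_nhds)
    · filter_upwards [self_mem_nhdsWithin] with s hs
      have : s ≠ 1 := ne_of_gt hs
      simpa using this
  have h3 := (Complex.continuous_ofReal.tendsto _).comp (tendsto_Ysum (leg_sum_bd (p := p) hp2))
  have h4 := h3.mul h2
  rw [mul_one] at h4
  have h5 := tendsto_nhds_unique h1 (h4.congr' ?_)
  · exact_mod_cast h5
  · filter_upwards [Ioo_mem_nhdsGT (one_lt_two (α := ℝ))] with s hs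
    rw [zeta_factor hr hs.1, leg_LSeries hp2 hs.1 hs.2.le]
    simp only [Function.comp_apply]
    ring

lemma main_dvd {F : Type*} [Field F] [NumberField F] (hp3 : p % 4 = 3) (hpne3 : p ≠ 3)
    (hF2 : Module.finrank ℚ F = 2)
    (θ : F) (hθ : θ ^ 2 = -(p : F))
    (h : ℕ) (hh : h.Prime) (hhodd : h ≠ 2)
    (hdvd : h ∣ NumberField.classNumber F) : (h : ℤ) ∣ Tsum p := by
  have hp2 : p ≠ 2 := by rintro rfl; omega
  have hp := hpF.out
  obtain ⟨ω, m, hm, hω, tr1, trω⟩ := omega_facts hp hp3 hF2 θ hθ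
  obtain ⟨k, hk⟩ := discr_fact hF2 ω m hm hω tr1 trω
  obtain ⟨c1, c2, c3⟩ := reg_one_s15 hF2 (totally_complex hp.pos θ hθ)
  have hfr : Module.finrank ℤ (𝓞 F) = 2 := by rw [RingOfIntegers.rank, hF2]
  have hres := residue_eq_s15 (F := F) hp2 (fun n hn =>
    rcount_eq (O := 𝓞 F) hp3 hfr hm hω (Algebra.trace ℤ (𝓞 F)) tr1 trω hn)
  rw [dedekindZeta_residue_def, c1, c2, c3] at hres
  have hA := A_sq (p := p) hp3
  rw [← hres] at hA
  have hw : (Units.torsionOrder F : ℝ) ≠ 0 := by exact_mod_cast Units.torsionOrder_ne_zero F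
  have hd0 : (discr F : ℝ) ≠ 0 := by exact_mod_cast discr_ne_zero F
  have hd : |(discr F : ℝ)| * k ^ 2 = p := by
    have : (discr F : ℝ) * k ^ 2 = -p := by exact_mod_cast congrArg (Int.cast : ℤ → ℝ) hk
    rw [← abs_of_nonneg (sq_nonneg (k : ℝ)), ← abs_mul, this, abs_neg, abs_of_nonneg (by positivity)]
  have hsq : Real.sqrt |(discr F : ℝ)| ^ 2 = |(discr F : ℝ)| := Real.sq_sqrt (abs_nonneg _)
  rw [div_pow, mul_pow (Units.torsionOrder F : ℝ), hsq, div_mul_eq_mul_div, div_eq_iff (by positivity)] at hA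
  have hpi := Real.pi_ne_zero
  have hpr : (p : ℝ) ≠ 0 := by exact_mod_cast hp.ne_zero
  have key : (2 * (classNumber F : ℝ) * p * k) ^ 2 = ((Units.torsionOrder F : ℝ) * Tsum p) ^ 2 := by
    apply mul_left_cancel₀ (mul_ne_zero (pow_ne_zero 2 hpi) hpr)
    linear_combination (k : ℝ) ^ 2 * hA + (Real.pi ^ 2 * (Tsum p) ^ 2 * (Units.torsionOrder F : ℝ) ^ 2) * hd
  have keyZ : (2 * (classNumber F : ℤ) * p * k) ^ 2 = ((Units.torsionOrder F : ℤ) * Tsum p) ^ 2 := by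
    exact_mod_cast key
  have hprime : Prime (h : ℤ) := Nat.prime_iff_prime_int.mp hh
  have hd1 : (h : ℤ) ∣ (classNumber F : ℤ) := by exact_mod_cast hdvd
  have hd2 : (h : ℤ) ∣ ((Units.torsionOrder F : ℤ) * Tsum p) ^ 2 := by
    rw [← keyZ]
    refine dvd_pow (((hd1.mul_left 2).mul_right _).mul_right _) two_ne_zero
  rcases hprime.dvd_or_dvd (hprime.dvd_of_dvd_pow hd2) with h' | h'
  · exact absurd (by exact_mod_cast h') (not_dvd_torsion hp hpne3 hF2 θ hθ hh hhodd)
  · exact h'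
end assembly


theorem statement15
    (p : ℕ) (hp : p.Prime) (hp2 : p ≠ 2)
    (v : ℕ) (hv1 : 1 ≤ v) (hv2 : v ≤ p - 1)
    (hv : orderOf (v : ZMod p) = p - 1)
    (vn : ℤ → ℕ)
    (hvn1 : ∀ n : ℤ, 1 ≤ vn n) (hvn2 : ∀ n : ℤ, vn n ≤ p - 1)
    (hvn0 : vn 0 = 1)
    (hvnrec : ∀ n : ℤ, (vn (n + 1) : ZMod p) = (v : ZMod p) * (vn n : ZMod p))
    (hp3 : p % 4 = 3) (hpne3 : p ≠ 3)
    (F : Type*) [Field F] [NumberField F]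
    (hF2 : Module.finrank ℚ F = 2)
    (θ : F) (hθ : θ ^ 2 = -(p : F))
    (h : ℕ) (hh : h.Prime) (hhodd : h ≠ 2)
    (hdvd : h ∣ NumberField.classNumber F) :
    (h : ℤ) ∣ 2 * (∑ i ∈ Finset.range ((p - 1) / 2), (-1 : ℤ) ^ i * (vn (-(i : ℤ)) : ℤ)) - (p : ℤ) := by
  have : Fact p.Prime := ⟨hp⟩
  rw [sum_eq_T hp3 v hv vn hvn1 hvn2 hvn0 hvnrec]
  exact main_dvd hp3 hpne3 hF2 θ hθ h hh hhodd hdvd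
end
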